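/- Fix U, V ∈ ℂ with e^V = 1 + e^U, and let k̂ be an odd integer. For each odd positive integer n set q = exp(2πi/n), u = e^{U/n}, v = e^{V/n}, and Σₙ = Σ_{i=1}^{n} QDL^q(u, v | 2i) · q^{2i² − k̂ i}. Then, as n odd tends to ∞, Σₙ / (√n · e^{(n/(2π))·Λ(π/6)}) converges to 3^{−1/4} · 2^{(U−2πi)/(4πi)} · e^{−k̂ πi/6} · e^{−V/6} · ((1 − i√3)/2)^{(2πi−U)/(4πi)}. -/

import Mathlib

open Filter

/-- The discrete quantum dilogarithm `QDL^q(u,v | i) = v^{-i} ∏_{j=1}^i (1 + u q^{-2j})`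
for a natural index `i`, with `q = exp(2πi/n)`. -/
noncomputable def qdlAux (n : ℕ) (u v : ℂ) (i : ℕ) : ℂ :=
  v⁻¹ ^ i * ∏ k ∈ Finset.range i,
    (1 + u * Complex.exp (2 * Real.pi * Complex.I / n) ^ (-(2 * ((k : ℤ) + 1))))

/-- The discrete quantum dilogarithm, extended to all integer indices by `n`-periodicity. -/
noncomputable def QDL (n : ℕ) (u v : ℂ) (i : ℤ) : ℂ :=
  qdlAux n u v ((i % (n : ℤ)).toNat)

/-- The Lobachevsky function `Λ(θ) = -∫₀^θ log |2 sin t| dt`. -/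
noncomputable def lob (θ : ℝ) : ℝ := -∫ t in (0:ℝ)..θ, Real.log |2 * Real.sin t|

/-- The primitive `∫₀ˣ log (2 cos t) dt`. -/
noncomputable def logCosInt (x : ℝ) : ℝ := ∫ t in (0:ℝ)..x, Real.log (2 * Real.cos t)

lemma two_mul_cos_pos {x : ℝ} (h0 : -(Real.pi / 2) < x) (h1 : x < Real.pi / 2) :
    0 < 2 * Real.cos x := by
  have := Real.cos_pos_of_mem_Ioo ⟨h0, h1⟩
  linarith

lemma hasDerivAt_logCos {x : ℝ} (h0 : -(Real.pi / 2) < x) (h1 : x < Real.pi / 2) :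
    HasDerivAt (fun t => Real.log (2 * Real.cos t)) (-Real.tan x) x := by
  have h := two_mul_cos_pos h0 h1
  have := ((Real.hasDerivAt_cos x).const_mul 2).log h.ne'
  convert this using 1
  rw [Real.tan_eq_sin_div_cos]
  have : Real.cos x ≠ 0 := by intro h'; simp [h'] at h
  field_simp

lemma hasDerivAt_logCosInt {x : ℝ} (h0 : -(Real.pi / 2) < x) (h1 : x < Real.pi / 2) :
    HasDerivAt logCosInt (Real.log (2 * Real.cos x)) x := by
  have hpi := Real.pi_pos
  have hcont : ContinuousOn (fun t => Real.log (2 * Real.cos t))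
      (Set.Ioo (-(Real.pi / 2)) (Real.pi / 2)) := fun y hy =>
    (hasDerivAt_logCos hy.1 hy.2).continuousAt.continuousWithinAt
  apply intervalIntegral.integral_hasDerivAt_right
  · apply ContinuousOn.intervalIntegrable
    apply hcont.mono
    intro y hy
    have h2 : (0:ℝ) ∈ Set.Ioo (-(Real.pi / 2)) (Real.pi / 2) := ⟨by linarith, by linarith⟩
    exact (Set.ordConnected_Ioo.uIcc_subset h2 ⟨h0, h1⟩) hy
  · exact hcont.stronglyMeasurableAtFilter isOpen_Ioo x ⟨h0, h1⟩
  · exact (hasDerivAt_logCos h0 h1).continuousAt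

lemma logCosInt_pi_div_three : logCosInt (Real.pi / 3) = lob (Real.pi / 6) := by
  have hpi := Real.pi_pos
  have h1 : logCosInt (Real.pi / 3)
      = ∫ t in (Real.pi / 6)..(Real.pi / 2), Real.log (2 * Real.sin t) := by
    have := intervalIntegral.integral_comp_sub_left (a := (0:ℝ)) (b := Real.pi / 3)
      (fun t => Real.log (2 * Real.sin t)) (Real.pi / 2)
    simp only [Real.sin_pi_div_two_sub] at this
    rw [logCosInt, this]
    congr 1 <;> ring
  have h2 : lob (Real.pi / 6) = -∫ t in (0:ℝ)..(Real.pi / 6), Real.log (2 * Real.sin t) := by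
    rw [lob]
    simp only [Real.log_abs]
  have hl : ∀ a b : ℝ, IntervalIntegrable (fun t => Real.log (Real.sin t))
      MeasureTheory.volume a b := fun a b => intervalIntegrable_log_sin
  have h3 : ∀ a b : ℝ, 0 ≤ a → a ≤ b → b < Real.pi →
      ∫ t in a..b, Real.log (2 * Real.sin t)
        = (b - a) * Real.log 2 + ∫ t in a..b, Real.log (Real.sin t) := by
    intro a b ha hab hb
    rw [← smul_eq_mul (b - a), ← intervalIntegral.integral_const,
      ← intervalIntegral.integral_add intervalIntegrable_const (hl a b)]
    apply intervalIntegral.integral_congr_ae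
    refine Eventually.of_forall fun t ht => ?_
    rw [Set.uIoc_of_le hab] at ht
    have := Real.sin_pos_of_pos_of_lt_pi (lt_of_le_of_lt ha ht.1) (lt_of_le_of_lt ht.2 hb)
    rw [Real.log_mul two_ne_zero this.ne']
  have h4 := intervalIntegral.integral_add_adjacent_intervals (hl 0 (Real.pi / 6))
    (hl (Real.pi / 6) (Real.pi / 2))
  rw [integral_log_sin_zero_pi_div_two] at h4
  rw [h1, h2, h3 _ _ (by linarith) (by linarith) (by linarith),
    h3 _ _ (by linarith) (by linarith) (by linarith)]
  linarith

lemma lob_pi_div_six_pos : 0 < lob (Real.pi / 6) := by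
  have hpi := Real.pi_pos
  rw [← logCosInt_pi_div_three, logCosInt]
  apply intervalIntegral.intervalIntegral_pos_of_pos_on
  · apply ContinuousOn.intervalIntegrable
    intro y hy
    rw [Set.uIcc_of_le (by linarith)] at hy
    exact (hasDerivAt_logCos (by linarith [hy.1]) (by linarith [hy.2])).continuousAt.continuousWithinAt
  · intro x hx
    apply Real.log_pos
    have := Real.cos_lt_cos_of_nonneg_of_le_pi_div_two hx.1.le (by linarith) hx.2
    rw [Real.cos_pi_div_three] at this
    linarith
  · linarith

lemma log_two_mul_cos_pi_div_three : Real.log (2 * Real.cos (Real.pi / 3)) = 0 := by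
  rw [Real.cos_pi_div_three]; norm_num

/-- Second order expansion of `logCosInt` at its maximum `π / 3`. -/
lemma logCosInt_isLittleO :
    (fun x => logCosInt x - logCosInt (Real.pi / 3) + Real.sqrt 3 / 2 * (x - Real.pi / 3) ^ 2)
      =o[nhds (Real.pi / 3)] fun x => (x - Real.pi / 3) ^ 2 := by
  have hpi := Real.pi_pos
  set a := Real.pi / 3 with ha
  rw [Asymptotics.isLittleO_iff]
  intro c hc
  have hd := hasDerivAt_logCos (x := a) (by rw [ha]; linarith) (by rw [ha]; linarith)
  rw [hasDerivAt_iff_isLittleO, Asymptotics.isLittleO_iff] at hd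
  have hd := hd hc
  rw [log_two_mul_cos_pi_div_three, ha, Real.tan_pi_div_three, ← ha] at hd
  rw [Metric.eventually_nhds_iff] at hd ⊢
  obtain ⟨ε, hε, H⟩ := hd
  refine ⟨min ε (Real.pi / 6), by positivity, fun x hx => ?_⟩
  have hsub : ∀ y ∈ Set.uIcc a x, |y - a| ≤ |x - a| := fun y hy =>
    Set.abs_sub_left_of_mem_uIcc hy
  have hx' : |x - a| < min ε (Real.pi / 6) := by rwa [Real.dist_eq] at hx
  rw [lt_min_iff] at hx'
  have key := Convex.norm_image_sub_le_of_norm_hasDerivWithin_le (𝕜 := ℝ)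
    (f := fun y => logCosInt y - logCosInt a + Real.sqrt 3 / 2 * (y - a) ^ 2)
    (f' := fun y => Real.log (2 * Real.cos y) + Real.sqrt 3 * (y - a))
    (s := Set.uIcc a x) (C := c * |x - a|) (x := a) (y := x) ?_ ?_ (convex_uIcc a x)
    Set.left_mem_uIcc Set.right_mem_uIcc
  · simp only [sub_self, ne_eq, OfNat.ofNat_ne_zero, not_false_eq_true, zero_pow, mul_zero,
      add_zero, sub_zero] at key
    refine key.trans (le_of_eq ?_)
    rw [norm_pow, Real.norm_eq_abs]; ring
  · intro y hy
    have h1 := lt_of_le_of_lt (hsub y hy) hx'.2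
    rw [abs_lt] at h1
    have h2 := hasDerivAt_logCosInt (x := y) (by linarith [h1.1]) (by linarith [h1.2])
    have h3 := ((((hasDerivAt_id y).sub_const a).pow 2).const_mul (Real.sqrt 3 / 2))
    refine ((h2.sub_const _).add h3).hasDerivWithinAt.congr_deriv ?_
    simp
    ring
  · intro y hy
    have h1 := hsub y hy
    have h2 := H (y := y) (by rw [Real.dist_eq]; linarith)
    simp only [sub_zero, smul_eq_mul, mul_neg, sub_neg_eq_add] at h2
    rw [mul_comm (Real.sqrt 3)]
    refine h2.trans ?_
    exact mul_le_mul_of_nonneg_left h1 hc.le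

/-- A Lipschitz bound for `tan` on `[0, 5π/12]`. -/
lemma exists_tan_lipschitz : ∃ K : ℝ, 0 ≤ K ∧ ∀ x ∈ Set.Icc 0 (5 * Real.pi / 12),
    ∀ y ∈ Set.Icc 0 (5 * Real.pi / 12), |Real.tan y - Real.tan x| ≤ K * |y - x| := by
  have hpi := Real.pi_pos
  set κ := Real.cos (5 * Real.pi / 12)
  have hκ : 0 < κ := Real.cos_pos_of_mem_Ioo ⟨by linarith, by linarith⟩
  refine ⟨1 / κ ^ 2, by positivity, fun x hx y hy => ?_⟩
  have := Convex.norm_image_sub_le_of_norm_hasDerivWithin_le (𝕜 := ℝ) (f := Real.tan)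
    (f' := fun z => 1 / Real.cos z ^ 2) (s := Set.Icc 0 (5 * Real.pi / 12)) (C := 1 / κ ^ 2)
    (x := x) (y := y) ?_ ?_ (convex_Icc _ _) hx hy
  · simpa using this
  · intro z hz
    have : 0 < Real.cos z := Real.cos_pos_of_mem_Ioo ⟨by linarith [hz.1], by linarith [hz.2]⟩
    exact (Real.hasDerivAt_tan this.ne').hasDerivWithinAt
  · intro z hz
    have : κ ≤ Real.cos z := Real.cos_le_cos_of_nonneg_of_le_pi hz.1 (by linarith) hz.2
    rw [Real.norm_eq_abs, abs_of_nonneg (by positivity)]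
    gcongr

lemma abs_sum_tan_add_log_cos_le : ∃ K : ℝ, ∀ h : ℝ, 0 < h → ∀ r : ℕ,
    r * h ≤ 5 * Real.pi / 12 →
    |h * ∑ j ∈ Finset.range r, Real.tan ((j + 1) * h) + Real.log (Real.cos (r * h))|
      ≤ K * h ^ 2 * r := by
  have hpi := Real.pi_pos
  obtain ⟨K, hK, hT⟩ := exists_tan_lipschitz
  refine ⟨K, fun h hh r => ?_⟩
  induction r with
  | zero => simp
  | succ r ih =>
    intro hr
    push_cast at hr ⊢
    have ih := ih (by nlinarith)
    have hr0 : (0:ℝ) ≤ r * h := by positivity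
    have key := Convex.norm_image_sub_le_of_norm_hasDerivWithin_le (𝕜 := ℝ)
      (f := fun y => y * Real.tan ((r + 1) * h) + Real.log (Real.cos y))
      (f' := fun y => Real.tan ((r + 1) * h) - Real.tan y)
      (s := Set.Icc (r * h) ((r + 1) * h)) (C := K * h) (x := r * h) (y := (r + 1) * h) ?_ ?_
      (convex_Icc _ _) ⟨le_rfl, by nlinarith⟩ ⟨by nlinarith, le_rfl⟩
    · rw [Finset.sum_range_succ]
      rw [Real.norm_eq_abs, Real.norm_eq_abs] at key
      have e : |(r + 1) * h - r * h| = h := by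
        rw [abs_of_nonneg] <;> nlinarith
      rw [e] at key
      calc _ = |(h * ∑ j ∈ Finset.range r, Real.tan ((j + 1) * h) + Real.log (Real.cos (r * h)))
            + ((r + 1) * h * Real.tan ((r + 1) * h) + Real.log (Real.cos ((r + 1) * h)) -
              (r * h * Real.tan ((r + 1) * h) + Real.log (Real.cos (r * h))))| := by
            congr 1; ring
        _ ≤ _ := (abs_add_le _ _).trans (by linarith)
    · intro y hy
      have : 0 < Real.cos y := Real.cos_pos_of_mem_Ioo ⟨by linarith [hy.1], by linarith [hy.2]⟩
      have h1 := ((hasDerivAt_id y).mul_const (Real.tan ((r + 1) * h))).add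
        ((Real.hasDerivAt_cos y).log this.ne')
      refine h1.hasDerivWithinAt.congr_deriv ?_
      rw [Real.tan_eq_sin_div_cos y]; ring
    · intro y hy
      refine (hT y ⟨by linarith [hy.1], by linarith [hy.2]⟩ _ ⟨by nlinarith, hr⟩).trans ?_
      gcongr
      rw [abs_of_nonneg (by linarith [hy.2])]
      linarith [hy.1]

/-- The trapezoidal rule for `log (2 cos t)`. -/
lemma abs_sum_log_cos_sub_le : ∃ K : ℝ, ∀ h : ℝ, 0 < h → ∀ r : ℕ,
    r * h ≤ 5 * Real.pi / 12 →
    |h * ∑ j ∈ Finset.range r, Real.log (2 * Real.cos ((j + 1) * h)) - logCosInt (r * h)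
      - h / 2 * (Real.log (2 * Real.cos (r * h)) - Real.log 2)| ≤ K * h ^ 3 * r := by
  have hpi := Real.pi_pos
  obtain ⟨K, hK, hT⟩ := exists_tan_lipschitz
  refine ⟨K, fun h hh r => ?_⟩
  induction r with
  | zero => simp [logCosInt]
  | succ r ih =>
    intro hr
    push_cast at hr ⊢
    have ih := ih (by nlinarith)
    have hr0 : (0:ℝ) ≤ r * h := by positivity
    set x := (r:ℝ) * h with hx
    have hx1 : ((r:ℝ) + 1) * h = x + h := by rw [hx]; ring
    rw [hx1] at hr ⊢
    have hcos : ∀ y ∈ Set.Icc x (x + h), -(Real.pi / 2) < y ∧ y < Real.pi / 2 := fun y hy =>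
      ⟨by linarith [hy.1], by linarith [hy.2]⟩
    have inner : ∀ y ∈ Set.Icc x (x + h),
        |Real.log (2 * Real.cos y) - Real.log (2 * Real.cos x) + (y - x) * Real.tan y|
          ≤ K * h * h := by
      intro y hy
      have key := Convex.norm_image_sub_le_of_norm_hasDerivWithin_le (𝕜 := ℝ)
        (f := fun z => Real.log (2 * Real.cos z) + z * Real.tan y)
        (f' := fun z => -Real.tan z + Real.tan y)
        (s := Set.Icc x (x + h)) (C := K * h) (x := x) (y := y) ?_ ?_
        (convex_Icc _ _) ⟨le_rfl, by linarith⟩ hy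
      · rw [Real.norm_eq_abs, Real.norm_eq_abs] at key
        calc _ = |Real.log (2 * Real.cos y) + y * Real.tan y -
              (Real.log (2 * Real.cos x) + x * Real.tan y)| := by congr 1; ring
          _ ≤ _ := key
          _ ≤ _ := by
            gcongr
            rw [abs_of_nonneg (by linarith [hy.1])]
            linarith [hy.2]
      · intro z hz
        have h1 := (hasDerivAt_logCos (hcos z hz).1 (hcos z hz).2).add
          ((hasDerivAt_id z).mul_const (Real.tan y))
        exact h1.hasDerivWithinAt.congr_deriv (by ring)
      · intro z hz
        rw [neg_add_eq_sub]
        refine (hT z ⟨by linarith [hz.1], by linarith [hz.2]⟩ y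
          ⟨by linarith [hy.1], by linarith [hy.2]⟩).trans ?_
        gcongr
        rw [abs_le]
        constructor <;> linarith [hz.1, hz.2, hy.1, hy.2]
    have key := Convex.norm_image_sub_le_of_norm_hasDerivWithin_le (𝕜 := ℝ)
      (f := fun y => logCosInt y
        - (y - x) / 2 * (Real.log (2 * Real.cos x) + Real.log (2 * Real.cos y)))
      (f' := fun y => 1 / 2 *
        (Real.log (2 * Real.cos y) - Real.log (2 * Real.cos x) + (y - x) * Real.tan y))
      (s := Set.Icc x (x + h)) (C := K * h * h) (x := x) (y := x + h) ?_ ?_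
      (convex_Icc _ _) ⟨le_rfl, by linarith⟩ ⟨by linarith, le_rfl⟩
    · rw [Finset.sum_range_succ, hx1]
      rw [Real.norm_eq_abs, Real.norm_eq_abs] at key
      have e : |x + h - x| = h := by
        rw [abs_of_nonneg] <;> linarith
      rw [e] at key
      calc _ = |(h * ∑ j ∈ Finset.range r, Real.log (2 * Real.cos ((j + 1) * h)) - logCosInt x
              - h / 2 * (Real.log (2 * Real.cos x) - Real.log 2))
            - (logCosInt (x + h)
        - (x + h - x) / 2 * (Real.log (2 * Real.cos x) + Real.log (2 * Real.cos (x + h))) -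
          (logCosInt x
        - (x - x) / 2 * (Real.log (2 * Real.cos x) + Real.log (2 * Real.cos x))))| := by
            congr 1; ring
        _ ≤ _ := (abs_sub _ _).trans (by linarith)
    · intro y hy
      have h1 := (hasDerivAt_logCosInt (hcos y hy).1 (hcos y hy).2).sub
        ((((hasDerivAt_id y).sub_const x).div_const 2).mul
          ((hasDerivAt_logCos (hcos y hy).1 (hcos y hy).2).const_add (Real.log (2 * Real.cos x))))
      refine h1.hasDerivWithinAt.congr_deriv ?_
      simp
      ring
    · intro y hy
      have := inner y hy
      rw [norm_mul, Real.norm_eq_abs, Real.norm_eq_abs]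
      rw [abs_of_pos (by norm_num : (0:ℝ) < 1 / 2)]
      have h0 := abs_nonneg (Real.log (2 * Real.cos y) - Real.log (2 * Real.cos x)
        + (y - x) * Real.tan y)
      linarith

/-- The angle `2π / (2m + 1)`. -/
noncomputable def stepAngle (m : ℕ) : ℝ := 2 * Real.pi / (2 * m + 1)

/-- The factor `e^{iθ} + e^{W/n} e^{-iθ}` at `θ = 2πj/n`, `n = 2m + 1`. -/
noncomputable def dilogFactor (m : ℕ) (W : ℂ) (j : ℕ) : ℂ :=
  Complex.exp ((j * stepAngle m : ℝ) * Complex.I) +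
    Complex.exp (W / (2 * m + 1)) * Complex.exp (-((j * stepAngle m : ℝ) * Complex.I))

/-- The product of the first `r` factors `e^{iθ} + e^{W/n} e^{-iθ}`. -/
noncomputable def dilogProd (m : ℕ) (W : ℂ) (r : ℕ) : ℂ :=
  ∏ j ∈ Finset.range r, dilogFactor m W (j + 1)

lemma stepAngle_pos (m : ℕ) : 0 < stepAngle m := by
  have := Real.pi_pos
  unfold stepAngle; positivity

lemma mul_stepAngle (m : ℕ) : (2 * (m:ℝ) + 1) * stepAngle m = 2 * Real.pi := by
  unfold stepAngle; field_simp

lemma two_mul_add_one_ne_zero (m : ℕ) : (2 * (m:ℂ) + 1) ≠ 0 := by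
  exact_mod_cast Nat.succ_ne_zero (2 * m)

lemma mul_stepAngle_complex (m : ℕ) :
    (2 * (m:ℂ) + 1) * (stepAngle m : ℂ) = 2 * Real.pi := by
  exact_mod_cast mul_stepAngle m

lemma prod_one_add_mul_exp (m : ℕ) (x : ℂ) :
    ∏ j ∈ Finset.range (2 * m + 1),
      (1 + x * Complex.exp (-(2 * ((j + 1) * stepAngle m) * Complex.I))) = 1 + x ^ (2 * m + 1) := by
  have hprim := Complex.isPrimitiveRoot_exp (2 * m + 1) (by omega)
  have hz : IsPrimitiveRoot (Complex.exp (-(2 * stepAngle m * Complex.I))) (2 * m + 1) := by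
    have h2 := (hprim.pow_of_coprime 2 (by simp)).inv
    have e : Complex.exp (-(2 * stepAngle m * Complex.I))
        = (Complex.exp (2 * Real.pi * Complex.I / ↑(2 * m + 1)) ^ 2)⁻¹ := by
      rw [← Complex.exp_nat_mul, ← Complex.exp_neg]
      congr 2
      simp only [stepAngle]
      push_cast
      ring
    rwa [e]
  have h1 := hz.pow_add_pow_eq_prod_add_mul 1 x ⟨m, rfl⟩
  rw [one_pow] at h1
  rw [h1]
  refine Finset.prod_bij (fun j _ => Complex.exp (-(2 * stepAngle m * Complex.I)) ^ (j + 1))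
    ?_ ?_ ?_ ?_
  · intro j _
    rw [Polynomial.mem_nthRootsFinset (by omega), pow_right_comm, hz.pow_eq_one, one_pow]
  · intro a ha b hb hab
    rw [Finset.mem_range] at ha hb
    rw [pow_succ, pow_succ] at hab
    exact hz.pow_inj ha hb (mul_right_cancel₀ (Complex.exp_ne_zero _) hab)
  · intro b hb
    rw [Polynomial.mem_nthRootsFinset (by omega)] at hb
    have hb' : (b * (Complex.exp (-(2 * stepAngle m * Complex.I)))⁻¹) ^ (2 * m + 1) = 1 := by
      rw [mul_pow, hb, inv_pow, hz.pow_eq_one]; simp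
    obtain ⟨i, hi, hi'⟩ := hz.eq_pow_of_pow_eq_one hb'
    refine ⟨i, Finset.mem_range.2 hi, ?_⟩
    rw [pow_succ, hi', inv_mul_cancel_right₀ (Complex.exp_ne_zero _)]
  · intro j _
    rw [mul_comm x, ← Complex.exp_nat_mul]
    congr 3
    push_cast
    ring

lemma dilogFactor_eq (m : ℕ) (W : ℂ) (j : ℕ) :
    dilogFactor m W j = Complex.exp (j * stepAngle m * Complex.I) *
      (1 + Complex.exp (W / (2 * m + 1)) * Complex.exp (-(2 * (j * stepAngle m) * Complex.I))) := by
  rw [dilogFactor, mul_add, mul_one]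
  push_cast
  congr 1
  rw [← Complex.exp_add, ← Complex.exp_add, ← Complex.exp_add]
  congr 1
  ring

lemma prod_exp_stepAngle (m r : ℕ) :
    ∏ j ∈ Finset.range r, Complex.exp ((j + 1 : ℕ) * stepAngle m * Complex.I)
      = Complex.exp (r * (r + 1) / 2 * stepAngle m * Complex.I) := by
  induction r with
  | zero => simp
  | succ r ih =>
    rw [Finset.prod_range_succ, ih, ← Complex.exp_add]
    congr 1
    push_cast
    ring

lemma dilogProd_eq (m : ℕ) (W : ℂ) (r : ℕ) :
    dilogProd m W r = Complex.exp (r * (r + 1) / 2 * stepAngle m * Complex.I) *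
      ∏ j ∈ Finset.range r, (1 + Complex.exp (W / (2 * m + 1)) *
        Complex.exp (-(2 * ((j + 1) * stepAngle m) * Complex.I))) := by
  simp only [dilogProd, dilogFactor_eq, Finset.prod_mul_distrib, prod_exp_stepAngle]
  push_cast
  rfl

lemma dilogProd_full (m : ℕ) (W : ℂ) : dilogProd m W (2 * m + 1) = 1 + Complex.exp W := by
  rw [dilogProd_eq, prod_one_add_mul_exp, ← Complex.exp_nat_mul]
  have h1 : ((2 * m + 1 : ℕ) : ℂ) * (W / (2 * m + 1)) = W := by
    push_cast
    field_simp [two_mul_add_one_ne_zero m]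
  have h2 : ((2 * m + 1 : ℕ) : ℂ) * ((2 * m + 1 : ℕ) + 1) / 2 * stepAngle m * Complex.I
      = (m + 1 : ℕ) * (2 * Real.pi * Complex.I) := by
    have := mul_stepAngle_complex m
    push_cast
    linear_combination ((m:ℂ) + 1) * Complex.I * this
  rw [h1, h2, Complex.exp_nat_mul, Complex.exp_two_pi_mul_I, one_pow, one_mul]

lemma dilogProd_add (m : ℕ) (W : ℂ) (r s : ℕ) :
    dilogProd m W (r + s) =
      dilogProd m W r * ∏ j ∈ Finset.range s, dilogFactor m W (r + (j + 1)) := by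
  simp only [dilogProd, Finset.prod_range_add, add_assoc]

lemma norm_dilogFactor (m : ℕ) (W : ℂ) (j : ℕ) :
    ‖dilogFactor m W j‖ = ‖1 + Complex.exp (W / (2 * m + 1)) *
      Complex.exp (-(2 * (j * stepAngle m) * Complex.I))‖ := by
  rw [dilogFactor_eq, norm_mul]
  have : ‖Complex.exp (j * stepAngle m * Complex.I)‖ = 1 := by
    exact_mod_cast Complex.norm_exp_ofReal_mul_I (j * stepAngle m)
  rw [this, one_mul]

lemma norm_dilogFactor_half_add (m : ℕ) (W : ℂ) (j : ℕ) :
    ‖dilogFactor m W (m + j)‖ = ‖dilogFactor m (W + 2 * Real.pi * Complex.I) j‖ := by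
  rw [norm_dilogFactor, norm_dilogFactor, ← Complex.exp_add, ← Complex.exp_add]
  congr 2
  rw [Complex.exp_eq_exp_iff_exists_int]
  refine ⟨-1, ?_⟩
  have h0 := two_mul_add_one_ne_zero m
  have h1 := mul_stepAngle_complex m
  have h2 : (stepAngle m : ℂ) = 2 * Real.pi / (2 * m + 1) := by
    field_simp; linear_combination h1
  rw [h2]
  push_cast
  field_simp
  ring

lemma norm_dilogProd_half_add (m : ℕ) (W : ℂ) (s : ℕ) :
    ‖dilogProd m W (m + s)‖ =
      ‖dilogProd m W m‖ * ‖dilogProd m (W + 2 * Real.pi * Complex.I) s‖ := by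
  rw [dilogProd_add, norm_mul, norm_prod]
  simp only [norm_dilogFactor_half_add, dilogProd, norm_prod]

lemma dilogFactor_zero_eq (m j : ℕ) :
    dilogFactor m 0 j = ((2 * Real.cos (j * stepAngle m) : ℝ) : ℂ) := by
  rw [dilogFactor]
  push_cast
  rw [Complex.cos]
  simp
  ring

lemma dilogFactor_zero_sub (m j : ℕ) (hj : j ≤ 2 * m + 1) :
    dilogFactor m 0 (2 * m + 1 - j) = dilogFactor m 0 j := by
  rw [dilogFactor_zero_eq, dilogFactor_zero_eq, Nat.cast_sub hj]
  push_cast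
  rw [← Complex.cos_two_pi_sub (j * stepAngle m)]
  congr 2
  have h1 := mul_stepAngle_complex m
  linear_combination h1

lemma norm_dilogProd_zero_half (m : ℕ) : ‖dilogProd m 0 m‖ = 1 := by
  have h := dilogProd_full m 0
  rw [dilogProd, Finset.prod_range_succ, ← dilogProd, show 2 * m = m + m by ring,
    dilogProd_add] at h
  have h1 : ∏ j ∈ Finset.range m, dilogFactor m 0 (m + (j + 1)) = dilogProd m 0 m := by
    rw [dilogProd, ← Finset.prod_range_reflect]
    refine Finset.prod_congr rfl fun j hj => ?_
    rw [Finset.mem_range] at hj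
    rw [← dilogFactor_zero_sub m (m + _) (by omega)]
    congr 1
    omega
  have h2 : dilogFactor m 0 (m + m + 1) = 2 := by
    rw [← two_mul, ← dilogFactor_zero_sub m _ le_rfl]
    simp [dilogFactor_zero_eq]
  rw [h1, h2] at h
  have h3 : dilogProd m 0 m * dilogProd m 0 m = 1 := by
    have : (2:ℂ) ≠ 0 := two_ne_zero
    simp at h
    linear_combination h / 2
  have h4 := congrArg norm h3
  rw [norm_mul, norm_one] at h4
  nlinarith [norm_nonneg (dilogProd m 0 m)]

lemma norm_dilogFactor_sub_le (m : ℕ) (W : ℂ) (j : ℕ) :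
    |‖dilogFactor m W j‖ - 2 * abs (Real.cos (j * stepAngle m))| ≤
      ‖Complex.exp (W / (2 * m + 1)) - 1‖ := by
  have h0 : 2 * |Real.cos (j * stepAngle m)| = ‖dilogFactor m 0 j‖ := by
    rw [dilogFactor_zero_eq, Complex.norm_real, Real.norm_eq_abs, abs_mul, abs_two]
  rw [h0]
  refine (abs_norm_sub_norm_le _ _).trans (le_of_eq ?_)
  have h1 : dilogFactor m W j - dilogFactor m 0 j =
      (Complex.exp (W / (2 * m + 1)) - 1) * Complex.exp ((-(j * stepAngle m) : ℝ) * Complex.I) := by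
    simp only [dilogFactor]
    push_cast
    simp
    ring
  rw [h1, norm_mul, Complex.norm_exp_ofReal_mul_I, mul_one]

lemma exists_norm_exp_sub_one_le (W : ℂ) : ∃ K : ℝ, 0 < K ∧ ∀ m : ℕ,
    ‖Complex.exp (W / (2 * m + 1)) - 1‖ ≤ K / (2 * m + 1) := by
  refine ⟨‖W‖ * Real.exp ‖W‖ + 1, by positivity, fun m => ?_⟩
  have hn : ‖(2 * (m:ℂ) + 1)‖ = 2 * m + 1 := by
    have := Complex.norm_natCast (2 * m + 1)
    push_cast at this
    exact this
  have h1 := Complex.norm_exp_sub_sum_le_norm_mul_exp (W / (2 * m + 1)) 1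
  simp only [Finset.range_one, Finset.sum_singleton, pow_zero, Nat.factorial_zero, Nat.cast_one,
    div_one, pow_one, norm_div, hn] at h1
  refine h1.trans ?_
  have hm : (1:ℝ) ≤ 2 * m + 1 := by linarith [Nat.cast_nonneg (α := ℝ) m]
  have h2 : ‖W‖ / (2 * m + 1) ≤ ‖W‖ := div_le_self (norm_nonneg _) hm
  rw [div_mul_eq_mul_div]
  gcongr
  have := Real.exp_le_exp.2 h2
  nlinarith [norm_nonneg W]

lemma norm_two_mul_add_one (m : ℕ) : ‖(2 * (m:ℂ) + 1)‖ = 2 * m + 1 := by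
  have := Complex.norm_natCast (2 * m + 1)
  push_cast at this
  exact this

lemma dilogFactor_mul_reflect (m : ℕ) (W : ℂ) (j : ℕ) (hj : j ≤ m) :
    dilogFactor m W j * dilogFactor m W (m - j) =
      -Complex.exp (W / (2 * m + 1)) *
        (Complex.exp ((W + Real.pi * Complex.I) / (2 * m + 1)) +
          Complex.exp (-((W + Real.pi * Complex.I) / (2 * m + 1))) +
          2 * Complex.cos (2 * (j * stepAngle m) + stepAngle m / 2)) := by
  have h0 := two_mul_add_one_ne_zero m
  have h1 := mul_stepAngle_complex m
  have h2 : (Real.pi * Complex.I) / (2 * m + 1) = stepAngle m / 2 * Complex.I := by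
    field_simp; linear_combination -h1
  have h3 : ((((m - j : ℕ) : ℝ) * stepAngle m : ℝ) : ℂ) * Complex.I =
      Real.pi * Complex.I - stepAngle m / 2 * Complex.I - j * stepAngle m * Complex.I := by
    rw [Nat.cast_sub hj]; push_cast
    linear_combination (Complex.I / 2) * h1
  rw [dilogFactor, dilogFactor, h3, add_div, h2, Complex.cos]
  push_cast
  have e1 : -(Real.pi * Complex.I - stepAngle m / 2 * Complex.I - j * stepAngle m * Complex.I) =
      -(Real.pi * Complex.I) + stepAngle m / 2 * Complex.I + j * stepAngle m * Complex.I := by ring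
  have e2 : (2 * (j * stepAngle m) + stepAngle m / 2) * Complex.I =
      j * stepAngle m * Complex.I + j * stepAngle m * Complex.I + stepAngle m / 2 * Complex.I := by
    ring
  have e3 : -(2 * (j * (stepAngle m:ℂ)) + stepAngle m / 2) * Complex.I =
      -(j * stepAngle m * Complex.I) + -(j * stepAngle m * Complex.I)
        + -(stepAngle m / 2 * Complex.I) := by
    ring
  rw [e1, e2, e3, neg_add]
  simp only [sub_eq_add_neg, Complex.exp_add, Complex.exp_neg, Complex.exp_pi_mul_I]
  have a1 := Complex.exp_ne_zero (j * stepAngle m * Complex.I)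
  have a2 := Complex.exp_ne_zero (stepAngle m / 2 * Complex.I)
  have a3 := Complex.exp_ne_zero (W / (2 * m + 1))
  field_simp
  ring

lemma norm_dilogFactor_mul_reflect_le (W : ℂ) : ∃ K : ℝ, 0 ≤ K ∧ ∀ᶠ m : ℕ in atTop,
    ∀ j ≤ m, ‖dilogFactor m W j * dilogFactor m W (m - j)‖ ≤
      ‖Complex.exp (W / (2 * m + 1))‖ *
        (‖dilogFactor m 0 j * dilogFactor m 0 (m - j)‖ + K / (2 * m + 1) ^ 2) := by
  have hE : ∀ x : ℂ, ‖x‖ ≤ 1 → ‖Complex.exp x + Complex.exp (-x) - 2‖ ≤ 2 * ‖x‖ ^ 2 := by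
    intro x hx
    have h1 := Complex.norm_exp_sub_one_sub_id_le hx
    have h2 := Complex.norm_exp_sub_one_sub_id_le (x := -x) (by rwa [norm_neg])
    rw [norm_neg] at h2
    calc _ = ‖(Complex.exp x - 1 - x) + (Complex.exp (-x) - 1 - -x)‖ := by congr 1; ring
      _ ≤ _ := (norm_add_le _ _).trans (by linarith)
  set A := ‖W + Real.pi * Complex.I‖ with hA
  set B := ‖0 + Real.pi * Complex.I‖ with hB
  refine ⟨2 * A ^ 2 + 2 * B ^ 2, by positivity, ?_⟩
  filter_upwards [eventually_ge_atTop ⌈A + B⌉₊] with m hm j hj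
  have hm' : A + B ≤ m := Nat.ceil_le.1 hm
  have hA0 : 0 ≤ A := norm_nonneg _
  have hB0 : 0 ≤ B := norm_nonneg _
  have hn : (0:ℝ) < 2 * m + 1 := by positivity
  have h1 := hE ((W + Real.pi * Complex.I) / (2 * m + 1)) (by
    rw [norm_div, norm_two_mul_add_one, div_le_one hn]; linarith)
  have h2 := hE ((0 + Real.pi * Complex.I) / (2 * m + 1)) (by
    rw [norm_div, norm_two_mul_add_one, div_le_one hn]; linarith)
  rw [norm_div, norm_two_mul_add_one, ← hA, div_pow] at h1
  rw [norm_div, norm_two_mul_add_one, ← hB, div_pow] at h2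
  have key : dilogFactor m W j * dilogFactor m W (m - j) = Complex.exp (W / (2 * m + 1)) *
      (dilogFactor m 0 j * dilogFactor m 0 (m - j)
      + -((Complex.exp ((W + Real.pi * Complex.I) / (2 * m + 1)) +
          Complex.exp (-((W + Real.pi * Complex.I) / (2 * m + 1))) - 2) -
        (Complex.exp ((0 + Real.pi * Complex.I) / (2 * m + 1)) +
          Complex.exp (-((0 + Real.pi * Complex.I) / (2 * m + 1))) - 2))) := by
    rw [dilogFactor_mul_reflect m W j hj, dilogFactor_mul_reflect m 0 j hj]
    simp only [zero_div, Complex.exp_zero]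
    ring
  rw [key, norm_mul]
  refine mul_le_mul_of_nonneg_left ((norm_add_le _ _).trans ?_) (norm_nonneg _)
  rw [norm_neg]
  refine add_le_add_right ((norm_sub_le _ _).trans ((add_le_add h1 h2).trans (le_of_eq ?_))) _
  ring

lemma le_abs_cos_mul_stepAngle (m j : ℕ) (hj : j ≤ m) :
    |2 * ((m:ℝ) - 2 * j) + 1| / (2 * m + 1) ≤ |Real.cos (j * stepAngle m)| := by
  have hpi := Real.pi_pos
  have hn : (0:ℝ) < 2 * m + 1 := by positivity
  have hj' : (j:ℝ) ≤ m := by exact_mod_cast hj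
  have hj0 : (0:ℝ) ≤ j := by positivity
  have e : Real.pi / 2 - j * stepAngle m
      = Real.pi / 2 * ((2 * ((m:ℝ) - 2 * j) + 1) / (2 * m + 1)) := by
    rw [stepAngle]; field_simp; ring
  have h := Real.mul_abs_le_abs_sin (x := Real.pi / 2 - j * stepAngle m) (by
    rw [e, abs_mul, abs_of_pos (by positivity : 0 < Real.pi / 2)]
    apply mul_le_of_le_one_right (by positivity)
    rw [abs_div, abs_of_pos hn, div_le_one hn, abs_le]
    constructor <;> linarith)
  rw [Real.sin_pi_div_two_sub, e, abs_mul, abs_of_pos (by positivity : 0 < Real.pi / 2), abs_div,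
    abs_of_pos hn] at h
  convert h using 1
  field_simp

lemma le_norm_dilogFactor_zero_mul_reflect (m j : ℕ) (hj : j ≤ m) :
    |4 * (((m:ℤ) - 2 * j : ℤ) : ℝ) ^ 2 - 1| / (2 * m + 1) ^ 2 ≤
      ‖dilogFactor m 0 j * dilogFactor m 0 (m - j)‖ := by
  have h1 := le_abs_cos_mul_stepAngle m j hj
  have h2 := le_abs_cos_mul_stepAngle m (m - j) (Nat.sub_le _ _)
  have h3 := mul_le_mul h1 h2 (by positivity) (abs_nonneg _)
  rw [norm_mul, dilogFactor_zero_eq, dilogFactor_zero_eq, Complex.norm_real, Complex.norm_real,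
    Real.norm_eq_abs, Real.norm_eq_abs, abs_mul, abs_mul, abs_two]
  calc _ = |2 * ((m:ℝ) - 2 * j) + 1| / (2 * m + 1) *
        (|2 * ((m:ℝ) - 2 * (m - j : ℕ)) + 1| / (2 * m + 1)) := by
        rw [div_mul_div_comm, ← abs_mul, Nat.cast_sub hj, ← abs_neg, ← sq]
        push_cast
        congr 2
        ring
    _ ≤ _ := h3
    _ ≤ _ := by
      nlinarith [mul_nonneg (abs_nonneg (Real.cos (j * stepAngle m)))
        (abs_nonneg (Real.cos (((m - j : ℕ) : ℝ) * stepAngle m)))]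

lemma summable_inv_abs_four_mul_sq_sub_one :
    Summable fun c : ℤ => |4 * (c:ℝ) ^ 2 - 1|⁻¹ := by
  have h := (Real.summable_one_div_int_pow (p := 2)).2 (by norm_num)
  refine Summable.of_norm_bounded_eventually h ?_
  have h0 : ({0}ᶜ : Set ℤ) ∈ (cofinite : Filter ℤ) := (Set.finite_singleton 0).compl_mem_cofinite
  filter_upwards [h0] with c hc
  have hc' : c ≠ 0 := by simpa using hc
  have : (1:ℝ) ≤ (c:ℝ) ^ 2 := by
    have : 1 ≤ c ^ 2 := by have := sq_nonneg c; have := pow_ne_zero 2 hc'; omega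
    exact_mod_cast this
  rw [norm_inv, Real.norm_eq_abs, abs_abs, abs_of_pos (by linarith), one_div]
  exact inv_anti₀ (by linarith) (by linarith)

/-- The product of the factors over half a period stays bounded. -/
lemma norm_dilogProd_half_le (W : ℂ) : ∃ C : ℝ, 0 < C ∧ ∀ᶠ m : ℕ in atTop,
    ‖dilogProd m W m‖ ≤ C := by
  obtain ⟨K, hK, hpair⟩ := norm_dilogFactor_mul_reflect_le W
  obtain ⟨K', hK', hexp⟩ := exists_norm_exp_sub_one_le W
  set G := ∑' c : ℤ, |4 * (c:ℝ) ^ 2 - 1|⁻¹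
  set D := Real.exp ‖W‖ * (4 * Real.exp (K * G)) with hD
  refine ⟨D + 1, by positivity, ?_⟩
  filter_upwards [hpair, eventually_ge_atTop ⌈K'⌉₊] with m hm hmK
  have hmK' : K' ≤ m := Nat.ceil_le.1 hmK
  have hn : (0:ℝ) < 2 * m + 1 := by positivity
  have hsplit : ∀ X : ℂ, ∏ j ∈ Finset.range (m + 1), dilogFactor m X j
      = dilogProd m X m * (1 + Complex.exp (X / (2 * m + 1))) := by
    intro X
    rw [Finset.prod_range_succ', dilogProd]
    simp [dilogFactor]
  have hsq : ∀ X : ℂ, ∏ j ∈ Finset.range (m + 1), (dilogFactor m X j * dilogFactor m X (m - j))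
      = (dilogProd m X m * (1 + Complex.exp (X / (2 * m + 1)))) ^ 2 := by
    intro X
    rw [Finset.prod_mul_distrib, sq, ← hsplit X]
    congr 1
    rw [← Finset.prod_range_reflect]
    refine Finset.prod_congr rfl fun j hj => ?_
    congr 1
    rw [Finset.mem_range] at hj
    omega
  have hone : (1:ℝ) ≤ ‖1 + Complex.exp (W / (2 * m + 1))‖ := by
    have h1 := hexp m
    have h2 : K' / (2 * m + 1) ≤ 1 := by rw [div_le_one hn]; linarith
    have h3 := norm_sub_norm_le (2:ℂ) (-(Complex.exp (W / (2 * m + 1)) - 1))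
    rw [norm_neg] at h3
    have h4 : (2:ℂ) - -(Complex.exp (W / (2 * m + 1)) - 1) = 1 + Complex.exp (W / (2 * m + 1)) := by
      ring
    rw [h4] at h3
    have : ‖(2:ℂ)‖ = 2 := by simp
    linarith
  have hG : ∑ j ∈ Finset.range (m + 1), |4 * (((m:ℤ) - 2 * j : ℤ) : ℝ) ^ 2 - 1|⁻¹ ≤ G := by
    have hinj : Function.Injective fun j : ℕ => ((m:ℤ) - 2 * j : ℤ) := by
      intro a b hab
      simp only at hab
      omega
    have := Summable.sum_le_tsum
      ((Finset.range (m + 1)).map ⟨fun j : ℕ => ((m:ℤ) - 2 * j : ℤ), hinj⟩)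
      (fun c _ => by positivity) summable_inv_abs_four_mul_sq_sub_one
    rw [Finset.sum_map] at this
    exact this
  have hbound : ∀ j ∈ Finset.range (m + 1), ‖dilogFactor m W j * dilogFactor m W (m - j)‖ ≤
      Real.exp (‖W‖ / (2 * m + 1)) * ‖dilogFactor m 0 j * dilogFactor m 0 (m - j)‖ *
        Real.exp (K * |4 * (((m:ℤ) - 2 * j : ℤ) : ℝ) ^ 2 - 1|⁻¹) := by
    intro j hj
    have hj' : j ≤ m := by rw [Finset.mem_range] at hj; omega
    have h1 := hm j hj'
    have h2 := le_norm_dilogFactor_zero_mul_reflect m j hj'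
    set p := ‖dilogFactor m 0 j * dilogFactor m 0 (m - j)‖
    set d := |4 * (((m:ℤ) - 2 * j : ℤ) : ℝ) ^ 2 - 1| with hd
    have hd0 : 0 < d := by
      rw [hd, abs_pos]
      intro h0
      have : 4 * ((m:ℤ) - 2 * j) ^ 2 - 1 = 0 := by exact_mod_cast h0
      omega
    have h3 : ‖Complex.exp (W / (2 * m + 1))‖ ≤ Real.exp (‖W‖ / (2 * m + 1)) := by
      refine (Complex.norm_exp_le_exp_norm _).trans (le_of_eq ?_)
      rw [norm_div, norm_two_mul_add_one]
    have h4 : p + K / (2 * m + 1) ^ 2 ≤ p * Real.exp (K * d⁻¹) := by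
      have h5 : K / (2 * m + 1) ^ 2 ≤ p * (K * d⁻¹) := by
        calc K / (2 * m + 1) ^ 2 = d / (2 * m + 1) ^ 2 * (K * d⁻¹) := by field_simp
          _ ≤ _ := by gcongr
      have h6 := Real.add_one_le_exp (K * d⁻¹)
      have h7 : 0 ≤ p := norm_nonneg _
      nlinarith
    calc _ ≤ _ := h1
      _ ≤ Real.exp (‖W‖ / (2 * m + 1)) * (p * Real.exp (K * d⁻¹)) := by gcongr
      _ = _ := by ring
  have hprod := Finset.prod_le_prod (fun j _ => norm_nonneg _) hbound
  rw [← norm_prod, hsq W, Finset.prod_mul_distrib, Finset.prod_mul_distrib, ← norm_prod, hsq 0,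
    norm_pow, norm_mul, norm_pow, norm_mul, norm_dilogProd_zero_half, Finset.prod_const,
    Finset.card_range, ← Real.exp_nat_mul, ← Real.exp_sum, ← Finset.mul_sum] at hprod
  have h8 : ((m + 1 : ℕ) : ℝ) * (‖W‖ / (2 * m + 1)) ≤ ‖W‖ := by
    rw [mul_div_assoc', div_le_iff₀ hn]
    push_cast
    nlinarith [norm_nonneg W, mul_nonneg (norm_nonneg W) (Nat.cast_nonneg (α := ℝ) m)]
  have h9 : ‖1 + Complex.exp (0 / (2 * (m:ℂ) + 1))‖ = 2 := by
    simp; norm_num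
  rw [h9] at hprod
  have h10 : ‖dilogProd m W m‖ ^ 2 ≤ D := by
    calc ‖dilogProd m W m‖ ^ 2 ≤ (‖dilogProd m W m‖ * ‖1 + Complex.exp (W / (2 * m + 1))‖) ^ 2 := by
          gcongr
          exact le_mul_of_one_le_right (norm_nonneg _) hone
      _ ≤ _ := hprod
      _ ≤ Real.exp ‖W‖ * (1 * 2) ^ 2 * Real.exp (K * G) := by gcongr
      _ = D := by rw [hD]; ring
  nlinarith [norm_nonneg (dilogProd m W m)]

/-- The exponential growth rate `exp (n Λ(π/6) / 2π)` for `n = 2m + 1`. -/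
noncomputable def peakScale (m : ℕ) : ℝ :=
  Real.exp (((2 * m + 1 : ℝ) / (2 * Real.pi)) * lob (Real.pi / 6))

lemma tendsto_two_mul_add_one : Tendsto (fun m : ℕ => (2 * m + 1 : ℝ)) atTop atTop :=
  tendsto_atTop_add_const_right _ _
    (tendsto_natCast_atTop_atTop.const_mul_atTop (by norm_num : (0:ℝ) < 2))

lemma tendsto_stepAngle : Tendsto stepAngle atTop (nhds 0) :=
  tendsto_const_nhds.div_atTop tendsto_two_mul_add_one

lemma stepAngle_mul_sqrt_mul (m : ℕ) (r : ℝ) :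
    r * stepAngle m - Real.pi / 3 = stepAngle m * Real.sqrt (2 * m + 1) *
      ((r - (2 * m + 1) / 6) / Real.sqrt (2 * m + 1)) := by
  have hn : (0:ℝ) < 2 * m + 1 := by positivity
  have := mul_stepAngle m
  have hs : Real.sqrt (2 * m + 1) ≠ 0 := (Real.sqrt_pos.2 hn).ne'
  field_simp
  linear_combination 3 * this

lemma tendsto_mul_stepAngle {r : ℕ → ℕ} {t : ℝ}
    (hr : Tendsto (fun m : ℕ => ((r m : ℝ) - (2 * m + 1) / 6) / Real.sqrt (2 * m + 1))
      atTop (nhds t)) :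
    Tendsto (fun m => r m * stepAngle m) atTop (nhds (Real.pi / 3)) := by
  have h1 : Tendsto (fun m => stepAngle m * Real.sqrt (2 * m + 1)) atTop (nhds 0) := by
    have h2 : ∀ m : ℕ, stepAngle m * Real.sqrt (2 * m + 1)
        = 2 * Real.pi / Real.sqrt (2 * m + 1) := by
      intro m
      have hn : (0:ℝ) < 2 * m + 1 := by positivity
      have hs := Real.sqrt_pos.2 hn
      rw [stepAngle, div_mul_eq_mul_div, div_eq_div_iff hn.ne' hs.ne', mul_assoc,
        Real.mul_self_sqrt hn.le]
    simp only [h2]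
    exact tendsto_const_nhds.div_atTop (Real.tendsto_sqrt_atTop.comp tendsto_two_mul_add_one)
  have h3 := (h1.mul hr).add_const (Real.pi / 3)
  simp only [zero_mul, zero_add] at h3
  refine h3.congr fun m => ?_
  rw [← stepAngle_mul_sqrt_mul]
  ring

lemma eventually_mul_stepAngle_le {r : ℕ → ℕ} {t : ℝ}
    (hr : Tendsto (fun m : ℕ => ((r m : ℝ) - (2 * m + 1) / 6) / Real.sqrt (2 * m + 1))
      atTop (nhds t)) :
    ∀ᶠ m in atTop, r m * stepAngle m ≤ 5 * Real.pi / 12 := by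
  have hpi := Real.pi_pos
  exact (tendsto_mul_stepAngle hr).eventually_le_const (by linarith)

lemma tendsto_sum_log_cos {r : ℕ → ℕ} {t : ℝ}
    (hr : Tendsto (fun m : ℕ => ((r m : ℝ) - (2 * m + 1) / 6) / Real.sqrt (2 * m + 1))
      atTop (nhds t)) :
    Tendsto (fun m : ℕ =>
      ∑ j ∈ Finset.range (r m), Real.log (2 * Real.cos ((j + 1) * stepAngle m)) -
        ((2 * m + 1 : ℝ) / (2 * Real.pi)) * lob (Real.pi / 6)) atTop
      (nhds (-(Real.sqrt 3 * Real.pi * t ^ 2) - Real.log 2 / 2)) := by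
  have hpi := Real.pi_pos
  have hx := tendsto_mul_stepAngle hr
  obtain ⟨K, hK⟩ := abs_sum_log_cos_sub_le
  -- the trapezoidal error
  have hE : Tendsto (fun m => (∑ j ∈ Finset.range (r m),
        Real.log (2 * Real.cos ((j + 1) * stepAngle m)))
        - logCosInt (r m * stepAngle m) / stepAngle m
        - 1 / 2 * (Real.log (2 * Real.cos (r m * stepAngle m)) - Real.log 2)) atTop (nhds 0) := by
    apply squeeze_zero_norm' (a := fun m => K * stepAngle m * (r m * stepAngle m))
    · filter_upwards [eventually_mul_stepAngle_le hr] with m hm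
      have hh := stepAngle_pos m
      have h1 := hK _ hh _ hm
      rw [Real.norm_eq_abs, ← mul_le_mul_iff_right₀ hh]
      nth_rewrite 1 [← abs_of_pos hh]
      rw [← abs_mul]
      calc _ = _ := by
            congr 1
            field_simp
        _ ≤ _ := h1
        _ = _ := by ring
    · have := (tendsto_stepAngle.const_mul K).mul hx
      simpa using this
  have hsq : Tendsto (fun m => (r m * stepAngle m - Real.pi / 3) ^ 2 / stepAngle m) atTop
      (nhds (2 * Real.pi * t ^ 2)) := by
    refine ((hr.pow 2).const_mul (2 * Real.pi)).congr fun m => ?_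
    have hn : (0:ℝ) < 2 * m + 1 := by positivity
    rw [stepAngle_mul_sqrt_mul, ← mul_stepAngle m, mul_pow, mul_pow, Real.sq_sqrt hn.le]
    have := (stepAngle_pos m).ne'
    field_simp
  have hS : Tendsto (fun m => (logCosInt (r m * stepAngle m) - logCosInt (Real.pi / 3))
      / stepAngle m) atTop (nhds (-(Real.sqrt 3 * Real.pi * t ^ 2))) := by
    have h1 := (logCosInt_isLittleO.comp_tendsto hx).mul_isBigO
      (Asymptotics.isBigO_refl (fun m => (stepAngle m)⁻¹) atTop)
    have h2 := (Asymptotics.isLittleO_one_iff ℝ).1 (h1.trans_isBigO (hsq.isBigO_one ℝ))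
    have h3 := h2.sub (hsq.const_mul (Real.sqrt 3 / 2))
    refine (h3.congr fun m => ?_).trans_eq ?_
    · simp only [Function.comp]
      ring
    · congr 1; ring
  have hc : Tendsto (fun m => 1 / 2 * (Real.log (2 * Real.cos (r m * stepAngle m)) - Real.log 2))
      atTop (nhds (1 / 2 * (0 - Real.log 2))) := by
    have h1 := (hasDerivAt_logCos (x := Real.pi / 3) (by linarith) (by linarith)).continuousAt
    have h2 := h1.tendsto.comp hx
    rw [log_two_mul_cos_pi_div_three] at h2
    exact (h2.sub_const _).const_mul _
  refine (((hE.add hS).add hc).congr fun m => ?_).trans_eq ?_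
  · have hn : (0:ℝ) < 2 * m + 1 := by positivity
    rw [logCosInt_pi_div_three]
    have : (2 * m + 1 : ℝ) / (2 * Real.pi) = 1 / stepAngle m := by
      rw [stepAngle]; field_simp
    rw [this]
    ring
  · congr 1; ring

lemma tendsto_mul_exp_div_sub_one (W : ℂ) :
    Tendsto (fun m : ℕ => (2 * m + 1 : ℂ) * (Complex.exp (W / (2 * m + 1)) - 1)) atTop
      (nhds W) := by
  rw [tendsto_iff_norm_sub_tendsto_zero]
  apply squeeze_zero' (g := fun m : ℕ => ‖W‖ ^ 2 / (2 * m + 1))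
  · exact Eventually.of_forall fun m => norm_nonneg _
  · filter_upwards [eventually_ge_atTop ⌈‖W‖⌉₊] with m hm
    have hm' : ‖W‖ ≤ m := Nat.ceil_le.1 hm
    have hn : (0:ℝ) < 2 * m + 1 := by positivity
    have h1 : ‖W / (2 * (m:ℂ) + 1)‖ = ‖W‖ / (2 * m + 1) := by
      rw [norm_div, norm_two_mul_add_one]
    have h := Complex.norm_exp_sub_one_sub_id_le (x := W / (2 * m + 1)) (by
      rw [h1, div_le_one hn]; linarith)
    have h2 : (2 * m + 1 : ℂ) * (Complex.exp (W / (2 * m + 1)) - 1) - W =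
        (2 * m + 1) * (Complex.exp (W / (2 * m + 1)) - 1 - W / (2 * m + 1)) := by
      field_simp [two_mul_add_one_ne_zero m]
    rw [h2, norm_mul, norm_two_mul_add_one]
    rw [h1] at h
    calc _ ≤ (2 * m + 1) * (‖W‖ / (2 * m + 1)) ^ 2 := by gcongr
      _ = _ := by field_simp
  · exact tendsto_const_nhds.div_atTop tendsto_two_mul_add_one

lemma tendsto_sum_tan {r : ℕ → ℕ} {t : ℝ}
    (hr : Tendsto (fun m : ℕ => ((r m : ℝ) - (2 * m + 1) / 6) / Real.sqrt (2 * m + 1))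
      atTop (nhds t)) :
    Tendsto (fun m : ℕ =>
      stepAngle m * ∑ j ∈ Finset.range (r m), Real.tan ((j + 1) * stepAngle m)) atTop
      (nhds (Real.log 2)) := by
  have hpi := Real.pi_pos
  have hx := tendsto_mul_stepAngle hr
  obtain ⟨K, hK⟩ := abs_sum_tan_add_log_cos_le
  have hE : Tendsto (fun m => stepAngle m * ∑ j ∈ Finset.range (r m),
      Real.tan ((j + 1) * stepAngle m) + Real.log (Real.cos (r m * stepAngle m)))
      atTop (nhds 0) := by
    apply squeeze_zero_norm' (a := fun m => K * stepAngle m * (r m * stepAngle m))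
    · filter_upwards [eventually_mul_stepAngle_le hr] with m hm
      exact (hK _ (stepAngle_pos m) _ hm).trans (le_of_eq (by ring))
    · have := (tendsto_stepAngle.const_mul K).mul hx
      simpa using this
  have hl : Tendsto (fun m => Real.log (Real.cos (r m * stepAngle m))) atTop
      (nhds (-Real.log 2)) := by
    have h1 : ContinuousAt (fun x => Real.log (Real.cos x)) (Real.pi / 3) :=
      Real.continuous_cos.continuousAt.log (by rw [Real.cos_pi_div_three]; norm_num)
    have h2 := h1.tendsto.comp hx
    rw [Real.cos_pi_div_three, one_div, Real.log_inv] at h2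
    exact h2
  simpa using hE.sub hl

/-- The perturbation of the factor `2 cos θ` relative to its unperturbed value. -/
noncomputable def relPert (m : ℕ) (W : ℂ) (j : ℕ) : ℂ :=
  (Complex.exp (W / (2 * m + 1)) - 1) *
    (1 - Complex.I * (Real.tan ((j + 1) * stepAngle m) : ℝ)) / 2

lemma dilogFactor_eq_mul_relPert (m : ℕ) (W : ℂ) (j : ℕ)
    (hj : ((j:ℝ) + 1) * stepAngle m ≤ 5 * Real.pi / 12) :
    dilogFactor m W (j + 1) =
      (2 * Real.cos ((j + 1) * stepAngle m) : ℝ) * (1 + relPert m W j) := by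
  have hpi := Real.pi_pos
  have hh := stepAngle_pos m
  have h0 : 0 ≤ ((j:ℝ) + 1) * stepAngle m := by positivity
  have hc : Real.cos ((j + 1) * stepAngle m) ≠ 0 :=
    (Real.cos_pos_of_mem_Ioo ⟨by linarith, by linarith⟩).ne'
  rw [dilogFactor, relPert, Real.tan_eq_sin_div_cos]
  push_cast
  rw [← neg_mul, Complex.exp_mul_I, Complex.exp_mul_I, Complex.cos_neg, Complex.sin_neg]
  have hc' : Complex.cos ((j + 1) * stepAngle m) ≠ 0 := by exact_mod_cast hc
  field_simp
  ring

lemma tendsto_prod_one_add_relPert (W : ℂ) {r : ℕ → ℕ} {t : ℝ}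
    (hr : Tendsto (fun m : ℕ => ((r m : ℝ) - (2 * m + 1) / 6) / Real.sqrt (2 * m + 1))
      atTop (nhds t)) :
    Tendsto (fun m => ∏ j ∈ Finset.range (r m), (1 + relPert m W j)) atTop
      (nhds (Complex.exp (W / 12 - Complex.I * W * (Real.log 2 : ℝ) / (4 * Real.pi)))) := by
  have hpi := Real.pi_pos
  have hpi' : (Real.pi : ℂ) ≠ 0 := by exact_mod_cast hpi.ne'
  obtain ⟨K, hK, hT⟩ := exists_tan_lipschitz
  obtain ⟨K', hK', hexp⟩ := exists_norm_exp_sub_one_le W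
  set M := K' * (1 + K * (5 * Real.pi / 12)) with hM
  have hM0 : 0 ≤ M := by positivity
  have hx := tendsto_mul_stepAngle hr
  have hsum : Tendsto (fun m => ∑ j ∈ Finset.range (r m), relPert m W j) atTop
      (nhds (W / 12 - Complex.I * W * (Real.log 2 : ℝ) / (4 * Real.pi))) := by
    have h1 := tendsto_mul_exp_div_sub_one W
    have h2 := (Complex.continuous_ofReal.tendsto _).comp (hx.div_const (2 * Real.pi))
    have h3 := (Complex.continuous_ofReal.tendsto _).comp
      ((tendsto_sum_tan hr).div_const (2 * Real.pi))
    have h4 := (h1.mul (h2.sub (h3.const_mul Complex.I))).div_const 2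
    refine (h4.congr fun m => ?_).trans_eq ?_
    · have hn := two_mul_add_one_ne_zero m
      simp only [relPert, Function.comp, ← Finset.sum_div, ← Finset.mul_sum,
        Finset.sum_sub_distrib, Finset.sum_const, Finset.card_range, nsmul_eq_mul, mul_one]
      rw [stepAngle]
      push_cast
      field_simp
    · congr 1
      push_cast
      field_simp
      ring
  have hb : ∀ᶠ m in atTop, ∀ j ∈ Finset.range (r m),
      ‖relPert m W j‖ ≤ M / (2 * m + 1) ∧ ‖relPert m W j‖ ≤ 1 / 2 := by
    filter_upwards [eventually_mul_stepAngle_le hr, eventually_ge_atTop ⌈M⌉₊] with m hm hmM j hj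
    have hmM' : M ≤ m := Nat.ceil_le.1 hmM
    have hn : (0:ℝ) < 2 * m + 1 := by positivity
    have hh := stepAngle_pos m
    have hj' : (j:ℝ) + 1 ≤ r m := by
      rw [Finset.mem_range] at hj
      exact_mod_cast hj
    have h0 : 0 ≤ ((j:ℝ) + 1) * stepAngle m := by positivity
    have h1 : ((j:ℝ) + 1) * stepAngle m ≤ 5 * Real.pi / 12 :=
      (mul_le_mul_of_nonneg_right hj' hh.le).trans hm
    have h2 := hT 0 ⟨le_rfl, by positivity⟩ _ ⟨h0, h1⟩
    rw [Real.tan_zero, sub_zero, sub_zero, abs_of_nonneg h0] at h2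
    have h3 : ‖(1:ℂ) - Complex.I * (Real.tan ((j + 1) * stepAngle m) : ℝ)‖
        ≤ 1 + K * (5 * Real.pi / 12) := by
      refine (norm_sub_le _ _).trans ?_
      rw [norm_one, norm_mul, Complex.norm_I, one_mul, Complex.norm_real, Real.norm_eq_abs]
      have := mul_le_mul_of_nonneg_left h1 hK
      linarith
    have h4 : ‖relPert m W j‖ ≤ M / (2 * m + 1) / 2 := by
      rw [relPert, norm_div, norm_mul, Complex.norm_ofNat]
      calc _ ≤ K' / (2 * m + 1) * (1 + K * (5 * Real.pi / 12)) / 2 := by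
            gcongr
            exact hexp m
        _ = _ := by rw [hM]; ring
    have h5 : 0 ≤ M / (2 * m + 1) := by positivity
    have h6 : M / (2 * m + 1) ≤ 1 := by rw [div_le_one hn]; linarith
    exact ⟨by linarith, by linarith⟩
  have hlog : Tendsto (fun m => ∑ j ∈ Finset.range (r m), Complex.log (1 + relPert m W j)
      - ∑ j ∈ Finset.range (r m), relPert m W j) atTop (nhds 0) := by
    apply squeeze_zero_norm' (a := fun m : ℕ => (r m * stepAngle m) * (M ^ 2 / (2 * Real.pi))
      / (2 * m + 1))
    · filter_upwards [hb] with m hm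
      rw [← Finset.sum_sub_distrib]
      have hn : (0:ℝ) < 2 * m + 1 := by positivity
      calc _ ≤ ∑ j ∈ Finset.range (r m), (M / (2 * m + 1)) ^ 2 := by
            refine norm_sum_le_of_le _ fun j hj => ?_
            obtain ⟨h1, h2⟩ := hm j hj
            refine (Complex.norm_log_one_add_sub_self_le (by linarith)).trans ?_
            have h3 : (1 - ‖relPert m W j‖)⁻¹ ≤ 2 := by
              rw [inv_le_comm₀ (by linarith) (by norm_num)]
              linarith
            calc _ ≤ ‖relPert m W j‖ ^ 2 * 2 / 2 := by gcongr
              _ = ‖relPert m W j‖ ^ 2 := by ring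
              _ ≤ _ := by gcongr
        _ = _ := by
            rw [Finset.sum_const, Finset.card_range, nsmul_eq_mul, stepAngle]
            field_simp
    · exact (hx.mul_const _).div_atTop tendsto_two_mul_add_one
  have hfin := (Complex.continuous_exp.tendsto _).comp (hlog.add hsum)
  rw [zero_add] at hfin
  refine hfin.congr' ?_
  filter_upwards [hb] with m hm
  simp only [Function.comp, sub_add_cancel]
  rw [Complex.exp_sum]
  refine Finset.prod_congr rfl fun j hj => Complex.exp_log fun h0 => ?_
  have h1 := (hm j hj).2
  have h2 : relPert m W j = -1 := by linear_combination h0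
  rw [h2] at h1
  norm_num at h1

/-- The behaviour of the product in the window of width `√n` around its peak `r = n / 6`. -/
lemma tendsto_dilogProd_div_peakScale (W : ℂ) {r : ℕ → ℕ} {t : ℝ}
    (hr : Tendsto (fun m : ℕ => ((r m : ℝ) - (2 * m + 1) / 6) / Real.sqrt (2 * m + 1))
      atTop (nhds t)) :
    Tendsto (fun m => dilogProd m W (r m) / (peakScale m : ℂ)) atTop
      (nhds ((Real.exp (-(Real.sqrt 3 * Real.pi * t ^ 2) - Real.log 2 / 2) : ℝ) *
        Complex.exp (W / 12 - Complex.I * W * (Real.log 2 : ℝ) / (4 * Real.pi)))) := by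
  have hpi := Real.pi_pos
  have h1 := (Complex.continuous_ofReal.tendsto _).comp
    ((Real.continuous_exp.tendsto _).comp (tendsto_sum_log_cos hr))
  refine (h1.mul (tendsto_prod_one_add_relPert W hr)).congr' ?_
  filter_upwards [eventually_mul_stepAngle_le hr] with m hm
  have hh := stepAngle_pos m
  have hj' : ∀ j ∈ Finset.range (r m), ((j:ℝ) + 1) * stepAngle m ≤ 5 * Real.pi / 12 := by
    intro j hj
    have : (j:ℝ) + 1 ≤ r m := by
      rw [Finset.mem_range] at hj
      exact_mod_cast hj
    exact (mul_le_mul_of_nonneg_right this hh.le).trans hm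
  rw [dilogProd, Finset.prod_congr rfl fun j hj => dilogFactor_eq_mul_relPert m W j (hj' j hj),
    Finset.prod_mul_distrib]
  simp only [Function.comp]
  rw [Real.exp_sub, Real.exp_sum, ← peakScale]
  have : ∏ j ∈ Finset.range (r m), Real.exp (Real.log (2 * Real.cos ((j + 1) * stepAngle m)))
      = ∏ j ∈ Finset.range (r m), (2 * Real.cos ((j + 1) * stepAngle m)) := by
    refine Finset.prod_congr rfl fun j hj => Real.exp_log ?_
    have h0 : 0 ≤ ((j:ℝ) + 1) * stepAngle m := by positivity
    exact two_mul_cos_pos (by linarith) (by linarith [hj' j hj])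
  rw [this]
  push_cast
  ring

lemma exp_neg_two_mul_le {v : ℝ} (h0 : 0 ≤ v) (h1 : v ≤ 1 / 2) : Real.exp (-(2 * v)) ≤ 1 - v := by
  rw [Real.exp_neg]
  apply inv_le_of_inv_le₀ (by linarith)
  refine le_trans ?_ (Real.add_one_le_exp (2 * v))
  rw [inv_le_iff_one_le_mul₀ (by linarith)]
  nlinarith

lemma exp_half_le {v : ℝ} (h0 : 0 ≤ v) (h1 : v ≤ 1) : Real.exp (v / 2) ≤ 1 + v := by
  rw [← neg_neg (v / 2), Real.exp_neg]
  apply inv_le_of_inv_le₀ (by linarith)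
  refine le_trans ?_ (Real.add_one_le_exp (-(v / 2)))
  rw [inv_le_iff_one_le_mul₀ (by linarith)]
  nlinarith

lemma three_halves_le_sqrt_three : 3 / 2 ≤ Real.sqrt 3 :=
  Real.le_sqrt_of_sq_le (by norm_num)

lemma le_two_mul_cos_pi_div_three_sub {y : ℝ} (h0 : 0 ≤ y) (h1 : y ≤ Real.pi / 3) :
    1 + y / Real.pi ≤ 2 * Real.cos (Real.pi / 3 - y) := by
  have hpi := Real.pi_pos
  have h2 := Real.one_sub_mul_le_cos h0 (by linarith)
  have h3 := Real.mul_le_sin h0 (by linarith)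
  have h4 := three_halves_le_sqrt_three
  rw [Real.cos_sub, Real.cos_pi_div_three, Real.sin_pi_div_three]
  have h5 : 0 ≤ Real.sin y := Real.sin_nonneg_of_nonneg_of_le_pi h0 (by linarith)
  have h6 := mul_le_mul_of_nonneg_right h4 h5
  have h7 : 2 / Real.pi * y = 2 * (y / Real.pi) := by ring
  rw [h7] at h2 h3
  linarith

lemma two_mul_cos_pi_div_three_add_le {y : ℝ} (h0 : 0 ≤ y) (h1 : y ≤ Real.pi / 6) :
    2 * Real.cos (Real.pi / 3 + y) ≤ 1 - y / (2 * Real.pi) := by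
  have hpi := Real.pi_pos
  have h3 := Real.mul_le_sin h0 (by linarith)
  have h4 := three_halves_le_sqrt_three
  rw [Real.cos_add, Real.cos_pi_div_three, Real.sin_pi_div_three]
  have h5 : 0 ≤ Real.sin y := Real.sin_nonneg_of_nonneg_of_le_pi h0 (by linarith)
  have h6 := mul_le_mul_of_nonneg_right h4 h5
  have h7 : 2 / Real.pi * y = 4 * (y / (2 * Real.pi)) := by ring
  have h8 : 0 ≤ y / (2 * Real.pi) := by positivity
  rw [h7] at h3
  linarith [Real.cos_le_one y]

/-- The size of the `j`-th factor: a geometric-type comparison up to `j = n / 4`, and one-sided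
bounds by `1` up to `exp (O(1 / n))` afterwards. -/
lemma exists_norm_dilogFactor_bounds (W : ℂ) : ∃ K : ℝ, 0 < K ∧ ∀ᶠ m : ℕ in atTop, ∀ j : ℕ,
    (6 * j ≤ 2 * m + 1 → Real.exp ((-((j:ℝ) - (2 * m + 1) / 6) - K) / (2 * m + 1)) ≤
      ‖dilogFactor m W j‖) ∧
    (2 * m + 1 ≤ 6 * j → 4 * j ≤ 2 * m + 1 → ‖dilogFactor m W j‖ ≤
      Real.exp ((-((j:ℝ) - (2 * m + 1) / 6) + K) / (2 * m + 1))) ∧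
    (2 * m + 1 ≤ 4 * j → 3 * j ≤ 2 * m + 1 → ‖dilogFactor m W j‖ ≤
      Real.exp (K / (2 * m + 1))) ∧
    (2 * m + 1 ≤ 3 * j → j ≤ m → Real.exp (-K / (2 * m + 1)) ≤ ‖dilogFactor m W j‖) := by
  obtain ⟨K, hK, hexp⟩ := exists_norm_exp_sub_one_le W
  have hpi := Real.pi_pos
  refine ⟨2 * K, by positivity, ?_⟩
  filter_upwards [eventually_ge_atTop ⌈K⌉₊] with m hm j
  have hmK : K ≤ m := Nat.ceil_le.1 hm
  have hn : (0:ℝ) < 2 * m + 1 := by positivity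
  have hab := abs_le.1 ((norm_dilogFactor_sub_le m W j).trans (hexp m))
  have hv0 : 0 ≤ K / (2 * m + 1) := by positivity
  have hv1 : K / (2 * m + 1) ≤ 1 / 2 := by rw [div_le_iff₀ hn]; linarith
  have hev := exp_neg_two_mul_le hv0 hv1
  have hmn := mul_stepAngle m
  have hpos := stepAngle_pos m
  have hj : (j:ℝ) * stepAngle m = j * (2 * Real.pi) / (2 * m + 1) := by
    rw [stepAngle]; ring
  set v := K / (2 * m + 1) with hv
  refine ⟨fun h => ?_, fun h h' => ?_, fun h h' => ?_, fun h h' => ?_⟩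
  · have h1 : 6 * (j:ℝ) ≤ 2 * m + 1 := by exact_mod_cast h
    set y := Real.pi / 3 - j * stepAngle m with hy
    have hy0 : 0 ≤ y := by rw [hy, hj, sub_nonneg, div_le_iff₀ hn]; nlinarith
    have hy1 : y ≤ Real.pi / 3 := by
      have : 0 ≤ j * stepAngle m := by positivity
      linarith
    have h2 := le_two_mul_cos_pi_div_three_sub hy0 hy1
    rw [hy, sub_sub_cancel, ← hy] at h2
    have hyp0 : 0 ≤ y / Real.pi := by positivity
    have hyp1 : y / Real.pi ≤ 1 := by rw [div_le_one hpi]; linarith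
    have h3 := exp_half_le hyp0 hyp1
    have hc : abs (Real.cos (j * stepAngle m)) = Real.cos (j * stepAngle m) :=
      abs_of_nonneg (by linarith)
    rw [hc] at hab
    have h4 : (-((j:ℝ) - (2 * m + 1) / 6) - 2 * K) / (2 * m + 1) = y / Real.pi / 2 + -(2 * v) := by
      rw [hy, hv, hj]; field_simp; ring
    rw [h4, Real.exp_add]
    calc _ ≤ (1 + y / Real.pi) * (1 - v) := by gcongr
      _ ≤ (2 * Real.cos (j * stepAngle m)) * (1 - v) := by gcongr; linarith
      _ ≤ _ := by nlinarith
  · have h1 : (2 * m + 1 : ℝ) ≤ 6 * j := by exact_mod_cast h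
    have h1' : 4 * (j:ℝ) ≤ 2 * m + 1 := by exact_mod_cast h'
    set y := j * stepAngle m - Real.pi / 3 with hy
    have hy0 : 0 ≤ y := by rw [hy, hj, sub_nonneg, le_div_iff₀ hn]; nlinarith
    have hy1 : y ≤ Real.pi / 6 := by
      have : j * stepAngle m ≤ Real.pi / 2 := by rw [hj, div_le_iff₀ hn]; nlinarith
      linarith
    have h2 := two_mul_cos_pi_div_three_add_le hy0 hy1
    have hyj : Real.pi / 3 + y = j * stepAngle m := by rw [hy]; ring
    rw [hyj] at h2
    have hc : abs (Real.cos (j * stepAngle m)) = Real.cos (j * stepAngle m) :=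
      abs_of_nonneg (Real.cos_nonneg_of_neg_pi_div_two_le_of_le (by linarith) (by linarith))
    rw [hc] at hab
    have h4 : (-((j:ℝ) - (2 * m + 1) / 6) + 2 * K) / (2 * m + 1)
        = -(y / (2 * Real.pi)) + 2 * v := by
      rw [hy, hv, hj]; field_simp; ring
    rw [h4]
    refine le_trans ?_ (Real.add_one_le_exp _)
    linarith
  · have h1 : (2 * m + 1 : ℝ) ≤ 4 * j := by exact_mod_cast h
    have h1' : 3 * (j:ℝ) ≤ 2 * m + 1 := by exact_mod_cast h'
    have hy0 : Real.pi / 2 ≤ j * stepAngle m := by rw [hj, le_div_iff₀ hn]; nlinarith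
    have hy1 : j * stepAngle m ≤ Real.pi - Real.pi / 3 := by rw [hj, div_le_iff₀ hn]; nlinarith
    have h2 := Real.cos_le_cos_of_nonneg_of_le_pi (by linarith) (by linarith) hy1
    rw [Real.cos_pi_sub, Real.cos_pi_div_three] at h2
    have h3 := Real.cos_nonpos_of_pi_div_two_le_of_le hy0 (by linarith)
    rw [abs_of_nonpos h3] at hab
    have h4 : 2 * K / (2 * m + 1) = 2 * v := by rw [hv]; ring
    rw [h4]
    refine le_trans ?_ (Real.add_one_le_exp _)
    linarith
  · have h1 : (2 * m + 1 : ℝ) ≤ 3 * j := by exact_mod_cast h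
    have h1' : (j:ℝ) ≤ m := by exact_mod_cast h'
    have hy0 : Real.pi - Real.pi / 3 ≤ j * stepAngle m := by rw [hj, le_div_iff₀ hn]; nlinarith
    have hy1 : j * stepAngle m ≤ Real.pi := by rw [hj, div_le_iff₀ hn]; nlinarith
    have h2 := Real.cos_le_cos_of_nonneg_of_le_pi (by linarith) hy1 hy0
    rw [Real.cos_pi_sub, Real.cos_pi_div_three] at h2
    rw [abs_of_nonpos (by linarith)] at hab
    have h4 : -(2 * K) / (2 * m + 1) = -(2 * v) := by rw [hv]; ring
    rw [h4]
    linarith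

lemma le_mul_exp_of_ratio_le {D E f : ℕ → ℝ} (hD : ∀ s, 0 ≤ D s)
    (hE : ∀ s, D (s + 1) = D s * E (s + 1)) {a b : ℕ}
    (h : ∀ s, a ≤ s → s < b → E (s + 1) ≤ Real.exp (f (s + 1) - f s)) {s : ℕ}
    (has : a ≤ s) (hsb : s ≤ b) : D s ≤ D a * Real.exp (f s - f a) := by
  induction s, has using Nat.le_induction with
  | base => simp
  | succ s has ih =>
    rw [hE]
    calc D s * E (s + 1) ≤ (D a * Real.exp (f s - f a)) * Real.exp (f (s + 1) - f s) :=
          (mul_le_mul_of_nonneg_left (h s has (by omega)) (hD s)).trans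
            (mul_le_mul_of_nonneg_right (ih (by omega)) (Real.exp_pos _).le)
      _ = _ := by rw [mul_assoc, ← Real.exp_add]; congr 2; ring

lemma le_mul_exp_of_le_ratio {D E f : ℕ → ℝ} (hD : ∀ s, 0 ≤ D s)
    (hE : ∀ s, D (s + 1) = D s * E (s + 1)) {a b : ℕ}
    (h : ∀ s, a ≤ s → s < b → Real.exp (f (s + 1) - f s) ≤ E (s + 1)) (hab : a ≤ b) :
    D a ≤ D b * Real.exp (f a - f b) := by
  induction b, hab using Nat.le_induction with
  | base => simp
  | succ s has ih =>
    rw [hE]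
    calc D a ≤ D s * Real.exp (f a - f s) := ih fun t h1 h2 => h t h1 (by omega)
      _ = D s * Real.exp (f (s + 1) - f s) * Real.exp (f a - f (s + 1)) := by
          rw [mul_assoc, ← Real.exp_add]; congr 2; ring
      _ ≤ _ := by
          gcongr
          · exact hD s
          · exact h s has (by omega)

lemma norm_dilogProd_succ (m : ℕ) (W : ℂ) (s : ℕ) :
    ‖dilogProd m W (s + 1)‖ = ‖dilogProd m W s‖ * ‖dilogFactor m W (s + 1)‖ := by
  rw [dilogProd, Finset.prod_range_succ, norm_mul, ← dilogProd]

lemma tendsto_div_six_sub_div_sqrt :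
    Tendsto (fun m : ℕ => ((((2 * m + 1) / 6 : ℕ) : ℝ) - (2 * m + 1) / 6) /
      Real.sqrt (2 * m + 1)) atTop (nhds 0) := by
  have h := (Real.tendsto_sqrt_atTop.comp tendsto_two_mul_add_one)
  apply squeeze_zero_norm' (a := fun m : ℕ => 1 / Real.sqrt (2 * m + 1)) _
    (tendsto_const_nhds.div_atTop h)
  refine Eventually.of_forall fun m => ?_
  rw [Real.norm_eq_abs, abs_div, abs_of_nonneg (Real.sqrt_nonneg _)]
  gcongr
  have h1 : 6 * ((2 * m + 1) / 6) ≤ 2 * m + 1 := by omega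
  have h2 : 2 * m + 1 ≤ 6 * ((2 * m + 1) / 6) + 6 := by omega
  have h1' : 6 * (((2 * m + 1) / 6 : ℕ) : ℝ) ≤ 2 * m + 1 := by exact_mod_cast h1
  have h2' : (2 * m + 1 : ℝ) ≤ 6 * (((2 * m + 1) / 6 : ℕ) : ℝ) + 6 := by exact_mod_cast h2
  rw [abs_le]
  constructor <;> linarith

lemma exists_norm_dilogProd_peak_le (W : ℂ) : ∃ C : ℝ, 0 < C ∧ ∀ᶠ m : ℕ in atTop,
    ‖dilogProd m W ((2 * m + 1) / 6)‖ ≤ C * peakScale m := by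
  have h := (tendsto_dilogProd_div_peakScale W tendsto_div_six_sub_div_sqrt).norm
  obtain ⟨C, hC⟩ := h.isBoundedUnder_le
  refine ⟨max C 1, by positivity, ?_⟩
  rw [eventually_map] at hC
  filter_upwards [hC] with m hm
  have hp : 0 < peakScale m := Real.exp_pos _
  rw [norm_div, Complex.norm_real, Real.norm_of_nonneg hp.le, div_le_iff₀ hp] at hm
  exact hm.trans (mul_le_mul_of_nonneg_right (le_max_left _ _) hp.le)

lemma exists_norm_dilogProd_le_quarter (W : ℂ) : ∃ C : ℝ, 0 < C ∧ ∀ᶠ m : ℕ in atTop,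
    ∀ s : ℕ, 4 * s ≤ 2 * m + 1 → ‖dilogProd m W s‖ ≤ C * peakScale m *
      Real.exp (-((s:ℝ) - (2 * m + 1) / 6) ^ 2 / 2 / (2 * m + 1)) := by
  obtain ⟨K, hK, hE⟩ := exists_norm_dilogFactor_bounds W
  obtain ⟨C, hC, hpeak⟩ := exists_norm_dilogProd_peak_le W
  refine ⟨C * Real.exp (2 * K + 2), by positivity, ?_⟩
  filter_upwards [hE, hpeak] with m hE hpeak s hs
  have hn : (0:ℝ) < 2 * m + 1 := by positivity
  have hn1 : (1:ℝ) ≤ 2 * m + 1 := by linarith [Nat.cast_nonneg (α := ℝ) m]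
  set s0 := (2 * m + 1) / 6 with hs0
  have h1 : 6 * s0 ≤ 2 * m + 1 := by omega
  have h2 : 2 * m + 1 ≤ 6 * s0 + 6 := by omega
  have h1' : 6 * (s0 : ℝ) ≤ 2 * m + 1 := by exact_mod_cast h1
  have h2' : (2 * m + 1 : ℝ) ≤ 6 * (s0 : ℝ) + 6 := by exact_mod_cast h2
  have hs' : 4 * (s : ℝ) ≤ 2 * m + 1 := by exact_mod_cast hs
  have hsn : (0:ℝ) ≤ s := Nat.cast_nonneg s
  suffices h : ‖dilogProd m W s‖ ≤ ‖dilogProd m W s0‖ *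
      Real.exp ((2 * K + 2) + -((s:ℝ) - (2 * m + 1) / 6) ^ 2 / 2 / (2 * m + 1)) by
    refine h.trans ?_
    rw [Real.exp_add, ← mul_assoc]
    have h3 := mul_le_mul_of_nonneg_right hpeak (Real.exp_pos (2 * K + 2)).le
    calc _ ≤ C * peakScale m * Real.exp (2 * K + 2) * _ :=
          mul_le_mul_of_nonneg_right h3 (Real.exp_pos _).le
      _ = _ := by ring
  rcases le_total s s0 with hss | hss
  · set f : ℕ → ℝ := fun s => (-((s:ℝ) - (2 * m + 1) / 6) ^ 2 / 2
      - (K + 1) * ((s:ℝ) - (2 * m + 1) / 6)) / (2 * m + 1) with hf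
    refine (le_mul_exp_of_le_ratio (D := fun s => ‖dilogProd m W s‖)
      (E := fun s => ‖dilogFactor m W s‖) (f := f) (fun s => norm_nonneg _) (norm_dilogProd_succ m W)
      (fun t ht ht' => ?_) hss).trans ?_
    · refine le_trans (Real.exp_le_exp.2 ?_) ((hE (t + 1)).1 (by omega))
      rw [hf]
      simp only
      rw [← sub_div]
      refine div_le_div_of_nonneg_right ?_ hn.le
      push_cast
      nlinarith
    · gcongr
      have hss' : (s:ℝ) ≤ s0 := by exact_mod_cast hss
      rw [hf]
      simp only
      rw [← sub_div, ← sub_le_iff_le_add, ← sub_div, div_le_iff₀ hn]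
      have hx0 : (s0:ℝ) - (2 * m + 1) / 6 ≤ 0 := by linarith
      have hx1 : -1 ≤ (s0:ℝ) - (2 * m + 1) / 6 := by linarith
      have hx2 : -(2 * m + 1) / 6 ≤ (s:ℝ) - (2 * m + 1) / 6 := by linarith
      have hx3 := mul_le_mul_of_nonneg_left hx2 (by linarith : 0 ≤ K + 1)
      have hx4 := mul_le_mul_of_nonneg_left hx0 (by linarith : 0 ≤ K + 1)
      have hx5 := mul_le_mul_of_nonneg_left hn1 hK.le
      nlinarith
  · set f : ℕ → ℝ := fun s => (-((s:ℝ) - (2 * m + 1) / 6) ^ 2 / 2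
      + K * ((s:ℝ) - (2 * m + 1) / 6)) / (2 * m + 1) with hf
    refine (le_mul_exp_of_ratio_le (D := fun s => ‖dilogProd m W s‖)
      (E := fun s => ‖dilogFactor m W s‖) (f := f) (b := s) (fun s => norm_nonneg _)
      (norm_dilogProd_succ m W) (fun t ht ht' => ?_) hss le_rfl).trans ?_
    · refine le_trans ((hE (t + 1)).2.1 (by omega) (by omega)) (Real.exp_le_exp.2 ?_)
      rw [hf]
      simp only
      rw [← sub_div]
      refine div_le_div_of_nonneg_right ?_ hn.le
      push_cast
      nlinarith
    · gcongr
      have hss' : (s0:ℝ) ≤ s := by exact_mod_cast hss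
      rw [hf]
      simp only
      rw [← sub_div, ← sub_le_iff_le_add, ← sub_div, div_le_iff₀ hn]
      have hx0 : (s0:ℝ) - (2 * m + 1) / 6 ≤ 0 := by linarith
      have hx1 : -1 ≤ (s0:ℝ) - (2 * m + 1) / 6 := by linarith
      have hx2 : (s:ℝ) - (2 * m + 1) / 6 ≤ (2 * m + 1) / 6 := by linarith
      have hx3 := mul_le_mul_of_nonneg_left hx2 hK.le
      have hx4 := mul_le_mul_of_nonneg_left hx1 hK.le
      have hx5 := mul_le_mul_of_nonneg_left hn1 hK.le
      nlinarith

lemma exists_norm_dilogProd_le_third (W : ℂ) : ∃ C : ℝ, 0 < C ∧ ∀ᶠ m : ℕ in atTop,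
    ∀ s : ℕ, 2 * m + 1 ≤ 4 * s → 3 * s ≤ 2 * m + 1 → ‖dilogProd m W s‖ ≤ C * peakScale m *
      Real.exp (-(1 / 32 * ((s:ℝ) - (2 * m + 1) / 6) ^ 2) / (2 * m + 1)) := by
  obtain ⟨K, hK, hE⟩ := exists_norm_dilogFactor_bounds W
  obtain ⟨C, hC, hquart⟩ := exists_norm_dilogProd_le_quarter W
  refine ⟨C * Real.exp K, by positivity, ?_⟩
  filter_upwards [hE, hquart, eventually_ge_atTop 12] with m hE hquart hm s hs hs3
  have hn : (0:ℝ) < 2 * m + 1 := by positivity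
  set s1 := (2 * m + 1) / 4 with hs1
  have h1 : 4 * s1 ≤ 2 * m + 1 := by omega
  have h2 : 2 * m + 1 ≤ 4 * s1 + 4 := by omega
  have h2' : (2 * m + 1 : ℝ) ≤ 4 * (s1 : ℝ) + 4 := by exact_mod_cast h2
  have hs' : 3 * (s : ℝ) ≤ 2 * m + 1 := by exact_mod_cast hs3
  have hs4 : (2 * m + 1 : ℝ) ≤ 4 * s := by exact_mod_cast hs
  have hm' : (12:ℝ) ≤ m := by exact_mod_cast hm
  have h3 := le_mul_exp_of_ratio_le (D := fun s => ‖dilogProd m W s‖)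
      (E := fun s => ‖dilogFactor m W s‖) (f := fun s => K * s / (2 * m + 1)) (a := s1) (b := s)
    (fun s => norm_nonneg _) (norm_dilogProd_succ m W) (fun t ht ht' => by
      refine ((hE (t + 1)).2.2.1 (by omega) (by omega)).trans (Real.exp_le_exp.2 ?_)
      rw [← sub_div]
      gcongr
      push_cast
      linarith) (by omega) le_rfl
  have h4 : Real.exp (K * s / (2 * m + 1) - K * s1 / (2 * m + 1)) ≤ Real.exp K := by
    gcongr
    rw [← sub_div, div_le_iff₀ hn]
    have : (0:ℝ) ≤ s1 := Nat.cast_nonneg s1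
    nlinarith
  have h5 : Real.exp (-((s1:ℝ) - (2 * m + 1) / 6) ^ 2 / 2 / (2 * m + 1)) ≤
      Real.exp (-(1 / 32 * ((s:ℝ) - (2 * m + 1) / 6) ^ 2) / (2 * m + 1)) := by
    gcongr
    have h6 : ((s:ℝ) - (2 * m + 1) / 6) ≤ 4 * ((s1:ℝ) - (2 * m + 1) / 6) := by linarith
    have h7 := pow_le_pow_left₀ (by linarith) h6 2
    linarith
  have hp : 0 < peakScale m := Real.exp_pos _
  calc _ ≤ _ := h3
    _ ≤ (C * peakScale m * Real.exp (-((s1:ℝ) - (2 * m + 1) / 6) ^ 2 / 2 / (2 * m + 1)))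
        * Real.exp K := by
      gcongr
      exact hquart s1 h1
    _ ≤ (C * peakScale m * Real.exp (-(1 / 32 * ((s:ℝ) - (2 * m + 1) / 6) ^ 2) / (2 * m + 1)))
        * Real.exp K := by gcongr
    _ = _ := by ring

lemma exists_norm_dilogProd_le_half (W : ℂ) : ∃ C : ℝ, 0 < C ∧ ∀ᶠ m : ℕ in atTop,
    ∀ s : ℕ, 2 * m + 1 ≤ 3 * s → s ≤ m → ‖dilogProd m W s‖ ≤ C := by
  obtain ⟨K, hK, hE⟩ := exists_norm_dilogFactor_bounds W
  obtain ⟨C, hC, hhalf⟩ := norm_dilogProd_half_le W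
  refine ⟨C * Real.exp K, by positivity, ?_⟩
  filter_upwards [hE, hhalf] with m hE hhalf s hs hsm
  have hn : (0:ℝ) < 2 * m + 1 := by positivity
  have h3 := le_mul_exp_of_le_ratio (D := fun s => ‖dilogProd m W s‖)
      (E := fun s => ‖dilogFactor m W s‖) (f := fun s => -K * s / (2 * m + 1)) (a := s) (b := m)
    (fun s => norm_nonneg _) (norm_dilogProd_succ m W) (fun t ht ht' => by
      refine le_trans (Real.exp_le_exp.2 ?_) ((hE (t + 1)).2.2.2 (by omega) (by omega))
      rw [← sub_div]
      gcongr
      push_cast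
      linarith) hsm
  refine h3.trans ?_
  gcongr
  rw [← sub_div, div_le_iff₀ hn]
  have : (0:ℝ) ≤ s := Nat.cast_nonneg s
  nlinarith [Nat.cast_nonneg (α := ℝ) m]

/-- Gaussian domination of the partial products up to half of the period. -/
lemma exists_norm_dilogProd_le (W : ℂ) : ∃ C c : ℝ, 0 < C ∧ 0 < c ∧ ∀ᶠ m : ℕ in atTop,
    ∀ s : ℕ, s ≤ m → ‖dilogProd m W s‖ ≤ C * peakScale m *
      Real.exp (-(c * ((s:ℝ) - (2 * m + 1) / 6) ^ 2) / (2 * m + 1)) := by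
  obtain ⟨C1, hC1, h1⟩ := exists_norm_dilogProd_le_quarter W
  obtain ⟨C2, hC2, h2⟩ := exists_norm_dilogProd_le_third W
  obtain ⟨C3, hC3, h3⟩ := exists_norm_dilogProd_le_half W
  have hl := lob_pi_div_six_pos
  have hpi := Real.pi_pos
  set L := lob (Real.pi / 6) / (2 * Real.pi) with hL
  have hL0 : 0 < L := by positivity
  set c := min (1 / 32) L with hc
  have hc0 : 0 < c := by positivity
  refine ⟨max (max C1 C2) C3, c, by positivity, hc0, ?_⟩
  filter_upwards [h1, h2, h3] with m h1 h2 h3 s hsm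
  have hn : (0:ℝ) < 2 * m + 1 := by positivity
  have hp : 0 < peakScale m := Real.exp_pos _
  rcases le_total (4 * s) (2 * m + 1) with hs | hs
  · refine (h1 s hs).trans ?_
    gcongr
    · exact (le_max_left _ _).trans (le_max_left _ _)
    · have : c ≤ 1 / 32 := min_le_left _ _
      nlinarith [sq_nonneg ((s:ℝ) - (2 * m + 1) / 6)]
  rcases le_total (3 * s) (2 * m + 1) with hs3 | hs3
  · refine (h2 s hs hs3).trans ?_
    gcongr
    · exact (le_max_right _ _).trans (le_max_left _ _)
    · exact min_le_left _ _
  · refine (h3 s hs3 hsm).trans ?_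
    rw [mul_assoc]
    refine (le_mul_of_one_le_right hC3.le ?_).trans
      (mul_le_mul_of_nonneg_right (le_max_right (max C1 C2) C3) (by positivity))
    rw [peakScale, ← Real.exp_add]
    apply Real.one_le_exp
    have e : (2 * (m:ℝ) + 1) / (2 * Real.pi) * lob (Real.pi / 6) = L * (2 * m + 1) := by
      rw [hL]; ring
    rw [e, ← sub_nonneg, sub_zero, neg_div, ← sub_eq_add_neg, sub_nonneg, div_le_iff₀ hn]
    have h4 : (s:ℝ) ≤ m := by exact_mod_cast hsm
    have h5 : (2 * m + 1 : ℝ) ≤ 3 * s := by exact_mod_cast hs3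
    have h6 : ((s:ℝ) - (2 * m + 1) / 6) ^ 2 ≤ (2 * m + 1) ^ 2 :=
      pow_le_pow_left₀ (by linarith) (by linarith) 2
    have h7 : c ≤ L := min_le_right _ _
    calc _ ≤ L * (2 * (m:ℝ) + 1) ^ 2 := by gcongr
      _ = _ := by ring

/-- The index in the peak window corresponding to the rescaled variable `t`. -/
noncomputable def windowIndex (t : ℝ) (m : ℕ) : ℕ :=
  ⌊(2 * m + 1 : ℝ) / 6 + Real.sqrt (2 * m + 1) * t⌋₊

lemma tendsto_sqrt_two_mul_add_one :
    Tendsto (fun m : ℕ => Real.sqrt (2 * m + 1)) atTop atTop :=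
  Real.tendsto_sqrt_atTop.comp tendsto_two_mul_add_one

lemma tendsto_window_atTop {a : ℝ} (ha : 0 < a) (t : ℝ) :
    Tendsto (fun m : ℕ => (2 * m + 1 : ℝ) * a + Real.sqrt (2 * m + 1) * t) atTop atTop := by
  have h := tendsto_sqrt_two_mul_add_one
  have h1 : Tendsto (fun m : ℕ => Real.sqrt (2 * m + 1) * a + t) atTop atTop :=
    tendsto_atTop_add_const_right _ _ (h.atTop_mul_const ha)
  refine (h.atTop_mul_atTop₀ h1).congr fun m => ?_
  have : Real.sqrt (2 * m + 1) ^ 2 = 2 * m + 1 := Real.sq_sqrt (by positivity)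
  linear_combination a * this

lemma eventually_window_nonneg (t : ℝ) :
    ∀ᶠ m : ℕ in atTop, 0 ≤ (2 * m + 1 : ℝ) / 6 + Real.sqrt (2 * m + 1) * t := by
  filter_upwards [(tendsto_window_atTop (by norm_num : (0:ℝ) < 1 / 6) t).eventually_ge_atTop 0]
    with m hm
  linarith

lemma eventually_windowIndex_lt (t : ℝ) : ∀ᶠ m : ℕ in atTop, windowIndex t m < m := by
  filter_upwards [(tendsto_window_atTop (by norm_num : (0:ℝ) < 1 / 3) (-t)).eventually_gt_atTop
    (1 / 2), eventually_window_nonneg t] with m hm h0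
  rw [windowIndex, Nat.floor_lt h0]
  linarith

lemma tendsto_windowIndex (t : ℝ) :
    Tendsto (fun m : ℕ => ((windowIndex t m : ℝ) - (2 * m + 1) / 6) / Real.sqrt (2 * m + 1))
      atTop (nhds t) := by
  rw [tendsto_iff_norm_sub_tendsto_zero]
  apply squeeze_zero' (Eventually.of_forall fun m => norm_nonneg _) _
    ((tendsto_const_nhds (x := (1:ℝ))).div_atTop tendsto_sqrt_two_mul_add_one)
  filter_upwards [eventually_window_nonneg t] with m h0
  have hs : 0 < Real.sqrt (2 * m + 1) := Real.sqrt_pos.2 (by positivity)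
  have h1 := Nat.floor_le h0
  have h2 := Nat.lt_floor_add_one ((2 * m + 1 : ℝ) / 6 + Real.sqrt (2 * m + 1) * t)
  rw [Real.norm_eq_abs, div_sub' hs.ne', abs_div, abs_of_pos hs]
  gcongr
  rw [windowIndex, abs_le]
  constructor <;> linarith

/-- A Riemann sum of step `1 / √n` centred at `n / 6`, with Gaussian domination. -/
lemma tendsto_sum_div_sqrt {f : ℕ → ℕ → ℂ} {N : ℕ → ℕ} {g : ℝ → ℂ} {C c : ℝ} (hc : 0 < c)
    (hN : ∀ m, m ≤ N m)
    (hf : ∀ᶠ m : ℕ in atTop, ∀ s < N m,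
      ‖f m s‖ ≤ C * Real.exp (-(c * ((s:ℝ) - (2 * m + 1) / 6) ^ 2) / (2 * m + 1)))
    (hlim : ∀ t, Tendsto (fun m => f m (windowIndex t m)) atTop (nhds (g t))) :
    Tendsto (fun m : ℕ => (∑ s ∈ Finset.range (N m), f m s) / (Real.sqrt (2 * m + 1) : ℂ))
      atTop (nhds (∫ t, g t)) := by
  set I : ℕ → ℕ → Set ℝ := fun m s => Set.Ico (((s:ℝ) - (2 * m + 1) / 6) / Real.sqrt (2 * m + 1))
    (((s:ℝ) + 1 - (2 * m + 1) / 6) / Real.sqrt (2 * m + 1)) with hI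
  have hs : ∀ m : ℕ, 0 < Real.sqrt (2 * m + 1) := fun m => Real.sqrt_pos.2 (by positivity)
  have hmem : ∀ m s t, t ∈ I m s ↔
      (s:ℝ) ≤ (2 * m + 1 : ℝ) / 6 + Real.sqrt (2 * m + 1) * t ∧
        (2 * m + 1 : ℝ) / 6 + Real.sqrt (2 * m + 1) * t < s + 1 := by
    intro m s t
    rw [hI, Set.mem_Ico, div_le_iff₀ (hs m), lt_div_iff₀ (hs m)]
    constructor <;> rintro ⟨h1, h2⟩ <;> constructor <;> linarith
  have hmem' : ∀ m s t, t ∈ I m s → s = windowIndex t m := by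
    intro m s t h
    rw [hmem] at h
    have h0 : 0 ≤ (2 * m + 1 : ℝ) / 6 + Real.sqrt (2 * m + 1) * t :=
      (Nat.cast_nonneg s).trans h.1
    exact ((Nat.floor_eq_iff h0).2 h).symm
  set F : ℕ → ℝ → ℂ := fun m t => ∑ s ∈ Finset.range (N m), (I m s).indicator (fun _ => f m s) t
    with hF
  have hFint : ∀ m, ∫ t, F m t =
      (∑ s ∈ Finset.range (N m), f m s) / (Real.sqrt (2 * m + 1) : ℂ) := by
    intro m
    rw [hF]
    simp only
    rw [MeasureTheory.integral_finsetSum, Finset.sum_div]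
    · refine Finset.sum_congr rfl fun s _ => ?_
      rw [MeasureTheory.integral_indicator measurableSet_Ico, MeasureTheory.setIntegral_const,
        Real.volume_real_Ico_of_le (by gcongr; linarith), ← sub_div, Complex.real_smul]
      push_cast
      ring
    · intro s _
      refine (MeasureTheory.integrable_indicator_iff measurableSet_Ico).2 ?_
      exact MeasureTheory.integrableOn_const (by simp)
  simp only [← hFint]
  refine MeasureTheory.tendsto_integral_filter_of_dominated_convergence
    (fun t => |C| * Real.exp c * Real.exp (-(c / 2) * t ^ 2)) ?_ ?_ ?_ ?_
  · refine Eventually.of_forall fun m => Measurable.aestronglyMeasurable ?_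
    exact Finset.measurable_fun_sum _ fun s _ => measurable_const.indicator measurableSet_Ico
  · filter_upwards [hf] with m hm
    refine Eventually.of_forall fun t => ?_
    by_cases h : ∃ s ∈ Finset.range (N m), t ∈ I m s
    · obtain ⟨s, hsN, hst⟩ := h
      have hFt : F m t = f m s := by
        rw [hF]
        simp only
        rw [Finset.sum_eq_single_of_mem s hsN, Set.indicator_of_mem hst]
        intro s' _ hne
        refine Set.indicator_of_notMem (fun h' => hne ?_) _
        rw [hmem' m s' t h', hmem' m s t hst]
      rw [hFt]
      refine (hm s (Finset.mem_range.1 hsN)).trans ?_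
      rw [mul_assoc, ← Real.exp_add]
      refine mul_le_mul (le_abs_self C) (Real.exp_le_exp.2 ?_) (Real.exp_pos _).le (abs_nonneg C)
      have hn : (1:ℝ) ≤ 2 * m + 1 := by linarith [Nat.cast_nonneg (α := ℝ) m]
      rw [div_le_iff₀ (by positivity)]
      obtain ⟨h1, h2⟩ := (hmem m s t).1 hst
      have hsq : Real.sqrt (2 * m + 1) ^ 2 = 2 * m + 1 := Real.sq_sqrt (by positivity)
      set R := Real.sqrt (2 * m + 1)
      set d := (2 * m + 1 : ℝ) / 6 + R * t - s with hd
      have e : (s:ℝ) - (2 * m + 1) / 6 = R * t - d := by rw [hd]; ring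
      rw [e]
      have h3 : (2 * m + 1 : ℝ) * t ^ 2 / 2 - (2 * m + 1) ≤ (R * t - d) ^ 2 := by
        have : d ^ 2 ≤ 1 := by
          rw [sq_le_one_iff_abs_le_one, abs_le]
          constructor <;> linarith
        nlinarith [sq_nonneg (R * t - 2 * d)]
      nlinarith [mul_le_mul_of_nonneg_left h3 hc.le]
    · have hFt : F m t = 0 := Finset.sum_eq_zero fun s hsN =>
        Set.indicator_of_notMem (fun h' => h ⟨s, hsN, h'⟩) _
      rw [hFt, norm_zero]
      positivity
  · exact (integrable_exp_neg_mul_sq (by positivity)).const_mul _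
  · refine Eventually.of_forall fun t => (hlim t).congr' ?_
    filter_upwards [eventually_window_nonneg t, eventually_windowIndex_lt t] with m h0 h1
    have hst : t ∈ I m (windowIndex t m) := by
      rw [hmem]
      exact ⟨Nat.floor_le h0, Nat.lt_floor_add_one _⟩
    rw [hF]
    simp only
    rw [Finset.sum_eq_single_of_mem (windowIndex t m) (Finset.mem_range.2 (h1.trans_le (hN m))),
      Set.indicator_of_mem hst]
    intro s' _ hne
    exact Set.indicator_of_notMem (fun h' => hne (hmem' m s' t h')) _

/-- The summand of the reindexed sum, `β = V + π i (k + 1)`. -/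
noncomputable def sigmaTerm (m : ℕ) (β U : ℂ) (r : ℕ) : ℂ :=
  Complex.exp (-(β * (r * stepAngle m) / (2 * Real.pi))) * dilogProd m U r

lemma exp_stepAngle_eq (m : ℕ) :
    2 * Real.pi * Complex.I / (2 * m + 1) = (stepAngle m : ℂ) * Complex.I := by
  rw [stepAngle]
  push_cast
  ring

lemma QDL_mul_eq_sigmaTerm (m : ℕ) (U V : ℂ) {k : ℤ} (hk : Odd k) (i : ℤ) {r : ℕ}
    (hr : r < 2 * m + 1) {l : ℤ} (hl : 2 * i = r + (2 * m + 1) * l) :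
    QDL (2 * m + 1) (Complex.exp (U / (2 * m + 1))) (Complex.exp (V / (2 * m + 1))) (2 * i) *
        Complex.exp (2 * Real.pi * Complex.I / (2 * m + 1)) ^ (2 * i ^ 2 - k * i) =
      sigmaTerm m (V + Real.pi * Complex.I * (k + 1)) U r := by
  have hpi : (Real.pi : ℂ) ≠ 0 := by exact_mod_cast Real.pi_ne_zero
  have hn := two_mul_add_one_ne_zero m
  have hmod : ((2 * i) % ((2 * m + 1 : ℕ) : ℤ)).toNat = r := by
    rw [hl]
    push_cast
    rw [Int.add_mul_emod_self_left, Int.emod_eq_of_lt (by positivity) (by exact_mod_cast hr),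
      Int.toNat_natCast]
  obtain ⟨w, hw⟩ : ∃ w : ℤ, (2 * m + 1) * l ^ 2 - k * l = 2 * w := by
    obtain ⟨k', rfl⟩ := hk
    obtain ⟨c, hc⟩ := Int.even_mul_succ_self (l - 1)
    refine ⟨m * l ^ 2 - k' * l + c, ?_⟩
    linear_combination hc
  rw [QDL, hmod, qdlAux, sigmaTerm, dilogProd_eq]
  have hprod : ∀ j ∈ Finset.range r, (1 + Complex.exp (U / (2 * m + 1)) *
      Complex.exp (2 * Real.pi * Complex.I / (2 * m + 1 : ℕ)) ^ (-(2 * ((j : ℤ) + 1)))) =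
      1 + Complex.exp (U / (2 * m + 1)) *
        Complex.exp (-(2 * ((j + 1) * stepAngle m) * Complex.I)) := by
    intro j _
    push_cast
    rw [exp_stepAngle_eq, ← Complex.exp_int_mul]
    push_cast
    congr 3
    ring
  rw [Finset.prod_congr rfl hprod, ← Complex.exp_neg, ← Complex.exp_nat_mul, exp_stepAngle_eq,
    ← Complex.exp_int_mul, mul_right_comm, ← Complex.exp_add,
    ← mul_assoc (Complex.exp _), ← Complex.exp_add]
  congr 1
  rw [Complex.exp_eq_exp_iff_exists_int]
  refine ⟨r * l + w, ?_⟩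
  have hlc : (2 * i : ℂ) = r + (2 * m + 1) * l := by exact_mod_cast hl
  have hwc : ((2 * m + 1) * l ^ 2 - k * l : ℂ) = 2 * w := by exact_mod_cast hw
  have hi : (i : ℂ) = (r + (2 * m + 1) * l) / 2 := by linear_combination hlc / 2
  have hwc' : (w : ℂ) = ((2 * m + 1) * l ^ 2 - k * l) / 2 := by linear_combination -hwc / 2
  rw [stepAngle]
  push_cast
  rw [hi, hwc']
  field_simp
  ring

lemma sum_QDL_eq_sum_sigmaTerm (m : ℕ) (U V : ℂ) {k : ℤ} (hk : Odd k) :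
    (∑ i ∈ Finset.Icc 1 (2 * m + 1),
        QDL (2 * m + 1) (Complex.exp (U / (2 * m + 1))) (Complex.exp (V / (2 * m + 1)))
            (2 * (i : ℤ)) *
          Complex.exp (2 * Real.pi * Complex.I / (2 * m + 1)) ^ (2 * (i : ℤ) ^ 2 - k * i)) =
      ∑ r ∈ Finset.range (2 * m + 1), sigmaTerm m (V + Real.pi * Complex.I * (k + 1)) U r := by
  refine Finset.sum_nbij' (fun i => if i ≤ m then 2 * i else if i = 2 * m + 1 then 0
      else 2 * i - (2 * m + 1))
    (fun r => if r = 0 then 2 * m + 1 else if r % 2 = 0 then r / 2 else (r + (2 * m + 1)) / 2)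
    ?_ ?_ ?_ ?_ ?_
  · intro i hi
    rw [Finset.mem_Icc] at hi
    rw [Finset.mem_range]
    split_ifs <;> omega
  · intro r hr
    rw [Finset.mem_range] at hr
    rw [Finset.mem_Icc]
    split_ifs <;> omega
  · intro i hi
    rw [Finset.mem_Icc] at hi
    split_ifs <;> omega
  · intro r hr
    rw [Finset.mem_range] at hr
    split_ifs <;> omega
  · intro i hi
    rw [Finset.mem_Icc] at hi
    split_ifs with h1 h2
    · exact QDL_mul_eq_sigmaTerm m U V hk i (l := 0) (by omega) (by push_cast; ring)
    · exact QDL_mul_eq_sigmaTerm m U V hk i (l := 2) (by omega) (by rw [h2]; push_cast; ring)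
    · refine QDL_mul_eq_sigmaTerm m U V hk i (l := 1) (by omega) ?_
      rw [Nat.cast_sub (by omega)]
      push_cast
      ring

/-- The ratio of consecutive terms. -/
noncomputable def sigmaRatio (m : ℕ) (β U : ℂ) (r : ℕ) : ℂ :=
  Complex.exp (-(β * stepAngle m / (2 * Real.pi))) * dilogFactor m U (r + 1)

lemma sigmaTerm_succ (m : ℕ) (β U : ℂ) (r : ℕ) :
    sigmaTerm m β U (r + 1) = sigmaTerm m β U r * sigmaRatio m β U r := by
  rw [sigmaTerm, sigmaTerm, sigmaRatio, dilogProd, Finset.prod_range_succ, ← dilogProd,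
    mul_mul_mul_comm, ← Complex.exp_add]
  congr 2
  push_cast
  ring

lemma sigmaTerm_full (m : ℕ) {U V : ℂ} (hUV : Complex.exp V = 1 + Complex.exp U) {k : ℤ}
    (hk : Odd k) : sigmaTerm m (V + Real.pi * Complex.I * (k + 1)) U (2 * m + 1) = 1 := by
  obtain ⟨k', rfl⟩ := hk
  rw [sigmaTerm, dilogProd_full, ← hUV, ← Complex.exp_add, Complex.exp_eq_one_iff]
  refine ⟨-(k' + 1), ?_⟩
  have hpi : (Real.pi : ℂ) ≠ 0 := by exact_mod_cast Real.pi_ne_zero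
  push_cast
  rw [mul_stepAngle_complex]
  field_simp
  ring

/-- Averaging consecutive terms makes the contribution of the second half negligible. -/
lemma sum_sigmaTerm_eq (m : ℕ) {U V : ℂ} (hUV : Complex.exp V = 1 + Complex.exp U) {k : ℤ}
    (hk : Odd k) {β : ℂ} (hβ : β = V + Real.pi * Complex.I * (k + 1)) :
    ∑ r ∈ Finset.range (2 * m + 1), sigmaTerm m β U r =
      (∑ s ∈ Finset.range m, sigmaTerm m β U s * ((1 + sigmaRatio m β U s) / 2)) +
      ∑ s ∈ Finset.range (m + 1),
        sigmaTerm m β U (m + s) * ((1 + sigmaRatio m β U (m + s)) / 2) := by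
  have h0 : sigmaTerm m β U 0 = 1 := by simp [sigmaTerm, dilogProd]
  have h1 : sigmaTerm m β U (2 * m + 1) = 1 := by rw [hβ]; exact sigmaTerm_full m hUV hk
  have h2 : ∑ r ∈ Finset.range (2 * m + 1), sigmaTerm m β U (r + 1)
      = ∑ r ∈ Finset.range (2 * m + 1), sigmaTerm m β U r := by
    have h3 := Finset.sum_range_succ (sigmaTerm m β U) (2 * m + 1)
    rw [Finset.sum_range_succ', h0, h1] at h3
    exact add_right_cancel h3
  rw [← Finset.sum_range_add (fun r => sigmaTerm m β U r * ((1 + sigmaRatio m β U r) / 2)),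
    show m + (m + 1) = 2 * m + 1 by ring]
  have h4 : ∀ r, sigmaTerm m β U r * ((1 + sigmaRatio m β U r) / 2)
      = (sigmaTerm m β U r + sigmaTerm m β U (r + 1)) / 2 := by
    intro r
    rw [sigmaTerm_succ]
    ring
  simp only [h4]
  rw [← Finset.sum_div, Finset.sum_add_distrib, h2]
  ring

lemma div_two_mul_add_one_eq (m : ℕ) (W : ℂ) :
    W / (2 * m + 1) = W * stepAngle m / (2 * Real.pi) := by
  have hpi : (Real.pi : ℂ) ≠ 0 := by exact_mod_cast Real.pi_ne_zero
  have hn := two_mul_add_one_ne_zero m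
  rw [stepAngle]
  push_cast
  field_simp

lemma tendsto_stepAngle_complex : Tendsto (fun m => (stepAngle m : ℂ)) atTop (nhds 0) := by
  have h := (Complex.continuous_ofReal.tendsto _).comp tendsto_stepAngle
  rwa [Complex.ofReal_zero] at h

lemma tendsto_dilogFactor (W : ℂ) {j : ℕ → ℕ} {θ : ℝ}
    (hj : Tendsto (fun m => j m * stepAngle m) atTop (nhds θ)) :
    Tendsto (fun m => dilogFactor m W (j m)) atTop (nhds ((2 * Real.cos θ : ℝ) : ℂ)) := by
  have h1 := (Complex.continuous_ofReal.tendsto _).comp hj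
  have h2 := (Complex.continuous_exp.tendsto _).comp (h1.mul_const Complex.I)
  have h3 := (Complex.continuous_exp.tendsto _).comp (h1.mul_const Complex.I).neg
  have h4 := (Complex.continuous_exp.tendsto _).comp
    ((tendsto_stepAngle_complex.const_mul W).div_const (2 * Real.pi))
  refine ((h2.add (h4.mul h3)).congr fun m => ?_).trans_eq ?_
  · simp only [Function.comp, dilogFactor, div_two_mul_add_one_eq]
  · congr 1
    rw [mul_zero, zero_div, Complex.exp_zero, one_mul]
    push_cast
    rw [Complex.cos]
    ring_nf

lemma tendsto_sigmaRatio (β U : ℂ) {r : ℕ → ℕ} {θ : ℝ}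
    (hr : Tendsto (fun m => r m * stepAngle m) atTop (nhds θ)) :
    Tendsto (fun m => sigmaRatio m β U (r m)) atTop (nhds ((2 * Real.cos θ : ℝ) : ℂ)) := by
  have h1 : Tendsto (fun m => ((r m + 1 : ℕ) : ℝ) * stepAngle m) atTop (nhds θ) := by
    have := hr.add tendsto_stepAngle
    rw [add_zero] at this
    refine this.congr fun m => ?_
    push_cast
    ring
  have h2 := (Complex.continuous_exp.tendsto _).comp
    ((tendsto_stepAngle_complex.const_mul β).div_const (2 * Real.pi)).neg
  have h3 := h2.mul (tendsto_dilogFactor U (j := fun m => r m + 1) h1)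
  rw [mul_zero, zero_div, neg_zero, Complex.exp_zero, one_mul] at h3
  exact h3

lemma norm_exp_neg_mul_div_le (β : ℂ) {x : ℝ} (h0 : 0 ≤ x) (h1 : x ≤ 2 * Real.pi) :
    ‖Complex.exp (-(β * x / (2 * Real.pi)))‖ ≤ Real.exp ‖β‖ := by
  have hpi := Real.pi_pos
  refine (Complex.norm_exp_le_exp_norm _).trans (Real.exp_le_exp.2 ?_)
  have e : β * x / (2 * Real.pi) = β * ((x / (2 * Real.pi) : ℝ) : ℂ) := by push_cast; ring
  rw [norm_neg, e, norm_mul, Complex.norm_real, Real.norm_of_nonneg (by positivity)]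
  exact mul_le_of_le_one_right (norm_nonneg β) ((div_le_one (by positivity)).2 h1)

lemma mul_stepAngle_le {m r : ℕ} (hr : r ≤ 2 * m + 1) : r * stepAngle m ≤ 2 * Real.pi := by
  rw [← mul_stepAngle m]
  exact mul_le_mul_of_nonneg_right (by exact_mod_cast hr) (stepAngle_pos m).le

lemma norm_sigmaTerm_le (β U : ℂ) {m r : ℕ} (hr : r ≤ 2 * m + 1) :
    ‖sigmaTerm m β U r‖ ≤ Real.exp ‖β‖ * ‖dilogProd m U r‖ := by
  rw [sigmaTerm, norm_mul]
  have hh := stepAngle_pos m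
  have h := norm_exp_neg_mul_div_le β (x := r * stepAngle m) (by positivity) (mul_stepAngle_le hr)
  push_cast at h
  gcongr

lemma norm_sigmaRatio_le (m : ℕ) (β U : ℂ) (r : ℕ) :
    ‖sigmaRatio m β U r‖ ≤ Real.exp ‖β‖ * (1 + Real.exp ‖U‖) := by
  have hh := stepAngle_pos m
  have hle : stepAngle m ≤ 2 * Real.pi := by
    simpa using mul_stepAngle_le (m := m) (r := 1) (by omega)
  rw [sigmaRatio, norm_mul]
  refine mul_le_mul (norm_exp_neg_mul_div_le β hh.le hle) ?_ (norm_nonneg _) (Real.exp_pos _).le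
  have h := norm_exp_neg_mul_div_le (-U) hh.le hle
  rw [norm_neg, neg_mul, neg_div, neg_neg, ← div_two_mul_add_one_eq] at h
  refine (norm_add_le _ _).trans ?_
  rw [norm_mul, Complex.norm_exp_ofReal_mul_I, ← neg_mul, ← Complex.ofReal_neg,
    Complex.norm_exp_ofReal_mul_I, mul_one]
  gcongr

lemma norm_one_add_sigmaRatio_div_two_le (m : ℕ) (β U : ℂ) (r : ℕ) :
    ‖(1 + sigmaRatio m β U r) / 2‖ ≤ 1 + Real.exp ‖β‖ * (1 + Real.exp ‖U‖) := by
  have h1 := norm_sigmaRatio_le m β U r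
  have h2 := norm_add_le 1 (sigmaRatio m β U r)
  rw [norm_one] at h2
  rw [norm_div, Complex.norm_ofNat]
  linarith [norm_nonneg (1 + sigmaRatio m β U r)]

lemma tendsto_first_half (β U : ℂ) :
    Tendsto (fun m : ℕ => (∑ s ∈ Finset.range m,
      sigmaTerm m β U s * ((1 + sigmaRatio m β U s) / 2) / (peakScale m : ℂ)) /
        (Real.sqrt (2 * m + 1) : ℂ)) atTop
      (nhds (∫ t : ℝ, Complex.exp (-(β / 6)) *
        ((Real.exp (-(Real.sqrt 3 * Real.pi * t ^ 2) - Real.log 2 / 2) : ℝ) *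
          Complex.exp (U / 12 - Complex.I * U * (Real.log 2 : ℝ) / (4 * Real.pi))))) := by
  have hpi : (Real.pi : ℂ) ≠ 0 := by exact_mod_cast Real.pi_ne_zero
  obtain ⟨C, c, hC, hc, hdom⟩ := exists_norm_dilogProd_le U
  set M := 1 + Real.exp ‖β‖ * (1 + Real.exp ‖U‖) with hM
  have hM0 : 0 < M := by positivity
  refine tendsto_sum_div_sqrt (C := Real.exp ‖β‖ * C * M) hc (fun m => le_rfl) ?_ fun t => ?_
  · filter_upwards [hdom] with m hm s hs
    have hp : 0 < peakScale m := Real.exp_pos _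
    rw [norm_div, norm_mul, Complex.norm_real, Real.norm_of_nonneg hp.le, div_le_iff₀ hp]
    calc _ ≤ (Real.exp ‖β‖ * (C * peakScale m * Real.exp (-(c * ((s:ℝ) - (2 * m + 1) / 6) ^ 2)
          / (2 * m + 1)))) * M := by
          gcongr
          · exact (norm_sigmaTerm_le β U (by omega)).trans
              (mul_le_mul_of_nonneg_left (hm s hs.le) (Real.exp_pos _).le)
          · exact norm_one_add_sigmaRatio_div_two_le m β U s
      _ = _ := by ring
  · have hr := tendsto_windowIndex t
    have h1 := tendsto_dilogProd_div_peakScale U hr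
    have h2 := tendsto_mul_stepAngle hr
    have h3 := tendsto_sigmaRatio β U h2
    have h4 := (Complex.continuous_ofReal.tendsto _).comp h2
    have h5 := (Complex.continuous_exp.tendsto _).comp
      ((h4.const_mul β).div_const (2 * Real.pi)).neg
    have h6 := (h5.mul h1).mul ((h3.const_add 1).div_const 2)
    refine (h6.congr fun m => ?_).trans_eq ?_
    · simp only [Function.comp, sigmaTerm]
      push_cast
      ring
    · rw [Real.cos_pi_div_three]
      congr 1
      have e : β * ((Real.pi / 3 : ℝ) : ℂ) / (2 * Real.pi) = β / 6 := by
        push_cast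
        field_simp
        ring
      rw [e]
      push_cast
      ring

lemma tendsto_second_half (β U : ℂ) :
    Tendsto (fun m : ℕ => (∑ s ∈ Finset.range (m + 1),
      sigmaTerm m β U (m + s) * ((1 + sigmaRatio m β U (m + s)) / 2) / (peakScale m : ℂ)) /
        (Real.sqrt (2 * m + 1) : ℂ)) atTop (nhds 0) := by
  obtain ⟨C, c, hC, hc, hdom⟩ := exists_norm_dilogProd_le (U + 2 * Real.pi * Complex.I)
  obtain ⟨C', hC', hhalf⟩ := norm_dilogProd_half_le U
  set M := 1 + Real.exp ‖β‖ * (1 + Real.exp ‖U‖) with hM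
  have hM0 : 0 < M := by positivity
  have hterm : ∀ᶠ m : ℕ in atTop, ∀ s ≤ m, ‖sigmaTerm m β U (m + s)‖ ≤
      Real.exp ‖β‖ * (C' * ‖dilogProd m (U + 2 * Real.pi * Complex.I) s‖) := by
    filter_upwards [hhalf] with m hm s hs
    refine (norm_sigmaTerm_le β U (by omega)).trans ?_
    rw [norm_dilogProd_half_add]
    gcongr
  rw [← MeasureTheory.integral_zero ℝ ℂ]
  refine tendsto_sum_div_sqrt (C := Real.exp ‖β‖ * C' * C * M) hc (fun m => Nat.le_succ m) ?_
    fun t => ?_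
  · filter_upwards [hdom, hterm] with m hm hterm s hs
    have hs' : s ≤ m := by omega
    have hp : 0 < peakScale m := Real.exp_pos _
    rw [norm_div, norm_mul, Complex.norm_real, Real.norm_of_nonneg hp.le, div_le_iff₀ hp]
    calc _ ≤ (Real.exp ‖β‖ * (C' * (C * peakScale m *
          Real.exp (-(c * ((s:ℝ) - (2 * m + 1) / 6) ^ 2) / (2 * m + 1))))) * M := by
          gcongr
          · refine (hterm s hs').trans ?_
            gcongr
            exact hm s hs'
          · exact norm_one_add_sigmaRatio_div_two_le m β U (m + s)
      _ = _ := by ring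
  · have hr := tendsto_windowIndex t
    have h1 := (tendsto_dilogProd_div_peakScale (U + 2 * Real.pi * Complex.I) hr).norm
    have h2 : Tendsto (fun m => ((m + windowIndex t m : ℕ) : ℝ) * stepAngle m) atTop
        (nhds (Real.pi / 3 + Real.pi)) := by
      have h := (tendsto_mul_stepAngle hr).add
        ((tendsto_const_nhds (x := Real.pi)).sub (tendsto_stepAngle.div_const 2))
      rw [zero_div, sub_zero] at h
      refine h.congr fun m => ?_
      push_cast
      linear_combination -(mul_stepAngle m) / 2
    have h3 := tendsto_sigmaRatio β U (r := fun m => m + windowIndex t m) h2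
    rw [Real.cos_add_pi, Real.cos_pi_div_three] at h3
    have h4 := ((h3.const_add 1).div_const 2).norm
    have h5 : ‖((1:ℂ) + ((2 * -(1 / 2) : ℝ) : ℂ)) / 2‖ = 0 := by norm_num
    rw [h5] at h4
    have h6 := (h1.mul h4).const_mul (Real.exp ‖β‖ * C')
    rw [mul_zero, mul_zero] at h6
    apply squeeze_zero_norm' _ h6
    filter_upwards [hterm, eventually_windowIndex_lt t] with m hm hlt
    rw [norm_div, norm_mul, norm_div (dilogProd _ _ _)]
    calc _ ≤ (Real.exp ‖β‖ * (C' * ‖dilogProd m (U + 2 * Real.pi * Complex.I)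
          (windowIndex t m)‖)) * ‖(1 + sigmaRatio m β U (m + windowIndex t m)) / 2‖ /
            ‖(peakScale m : ℂ)‖ := by
          gcongr
          exact hm _ hlt.le
      _ = _ := by ring

lemma integral_exp_gaussian :
    ∫ t : ℝ, Real.exp (-(Real.sqrt 3 * Real.pi * t ^ 2)) = (3 : ℝ) ^ (-(1 / 4 : ℝ)) := by
  have hpi := Real.pi_pos
  have e := integral_gaussian (Real.sqrt 3 * Real.pi)
  simp only [neg_mul] at e
  rw [e, Real.sqrt_eq_rpow, Real.sqrt_eq_rpow]
  have : Real.pi / ((3:ℝ) ^ (1 / 2 : ℝ) * Real.pi) = (3:ℝ) ^ (-(1 / 2 : ℝ)) := by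
    rw [Real.rpow_neg (by norm_num)]
    field_simp
  rw [this, ← Real.rpow_mul (by norm_num)]
  norm_num

lemma log_one_sub_I_mul_sqrt_three :
    Complex.log ((1 - Complex.I * (Real.sqrt 3 : ℂ)) / 2) = -(Real.pi / 3 * Complex.I) := by
  have hpi := Real.pi_pos
  have h : (1 - Complex.I * (Real.sqrt 3 : ℂ)) / 2 = Complex.exp (-(Real.pi / 3 * Complex.I)) := by
    rw [← neg_mul, Complex.exp_mul_I, Complex.cos_neg, Complex.sin_neg]
    have e : (Real.pi / 3 : ℂ) = ((Real.pi / 3 : ℝ) : ℂ) := by push_cast; rfl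
    rw [e, ← Complex.ofReal_cos, ← Complex.ofReal_sin, Real.cos_pi_div_three,
      Real.sin_pi_div_three]
    push_cast
    ring
  have him : (-(Real.pi / 3 * Complex.I)).im = -(Real.pi / 3) := by simp
  rw [h, Complex.log_exp] <;> rw [him] <;> linarith

lemma sigma_limit_eq (U V : ℂ) (k : ℤ) :
    (∫ t : ℝ, Complex.exp (-((V + Real.pi * Complex.I * (k + 1)) / 6)) *
        ((Real.exp (-(Real.sqrt 3 * Real.pi * t ^ 2) - Real.log 2 / 2) : ℝ) *
          Complex.exp (U / 12 - Complex.I * U * (Real.log 2 : ℝ) / (4 * Real.pi)))) =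
      (((3 : ℝ) ^ (-(1 / 4 : ℝ)) : ℝ) : ℂ) *
        (2 : ℂ) ^ ((U - 2 * Real.pi * Complex.I) / (4 * Real.pi * Complex.I)) *
        Complex.exp (-(k : ℂ) * Real.pi * Complex.I / 6) *
        Complex.exp (-V / 6) *
        ((1 - Complex.I * (Real.sqrt 3 : ℂ)) / 2) ^
          ((2 * Real.pi * Complex.I - U) / (4 * Real.pi * Complex.I)) := by
  have hpi : (Real.pi : ℂ) ≠ 0 := by exact_mod_cast Real.pi_ne_zero
  have hne : (1 - Complex.I * (Real.sqrt 3 : ℂ)) / 2 ≠ 0 := by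
    intro h
    have h1 := congrArg Complex.re h
    simp at h1
  rw [MeasureTheory.integral_const_mul, MeasureTheory.integral_mul_const, integral_complex_ofReal]
  simp only [sub_eq_add_neg _ (Real.log 2 / 2), Real.exp_add]
  rw [MeasureTheory.integral_mul_const, integral_exp_gaussian, Complex.ofReal_mul,
    Complex.ofReal_exp, Complex.cpow_def_of_ne_zero two_ne_zero, Complex.cpow_def_of_ne_zero hne,
    log_one_sub_I_mul_sqrt_three]
  have hlog : Complex.log 2 = ((Real.log 2 : ℝ) : ℂ) := by
    rw [Complex.ofReal_log (by norm_num)]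
    norm_num
  rw [hlog]
  simp only [mul_assoc]
  rw [mul_left_comm]
  congr 1
  simp only [← Complex.exp_add]
  congr 1
  push_cast
  field_simp
  ring_nf
  simp only [Complex.I_sq]
  ring

/-- Asymptotics of `Σₙ = Σ_{i=1}^n QDL^q(u,v | 2i) q^{2i² − k̂ i}`
as `n = 2m+1` odd tends to `∞`, when `k̂` is odd. -/
theorem sigma_asymptotics_odd
    (U V : ℂ) (hUV : Complex.exp V = 1 + Complex.exp U)
    (k : ℤ) (hk : Odd k) :
    Tendsto (fun m : ℕ =>
      (∑ i ∈ Finset.Icc 1 (2 * m + 1),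
          QDL (2 * m + 1) (Complex.exp (U / (2 * m + 1))) (Complex.exp (V / (2 * m + 1)))
              (2 * (i : ℤ)) *
            Complex.exp (2 * Real.pi * Complex.I / (2 * m + 1)) ^ (2 * (i : ℤ) ^ 2 - k * i)) /
        ((Real.sqrt (2 * m + 1) *
            Real.exp (((2 * m + 1 : ℝ) / (2 * Real.pi)) * lob (Real.pi / 6)) : ℝ) : ℂ))
      atTop
      (nhds ((((3 : ℝ) ^ (-(1 / 4 : ℝ)) : ℝ) : ℂ) *
        (2 : ℂ) ^ ((U - 2 * Real.pi * Complex.I) / (4 * Real.pi * Complex.I)) *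
        Complex.exp (-(k : ℂ) * Real.pi * Complex.I / 6) *
        Complex.exp (-V / 6) *
        ((1 - Complex.I * (Real.sqrt 3 : ℂ)) / 2) ^
          ((2 * Real.pi * Complex.I - U) / (4 * Real.pi * Complex.I)))) := by
  have h1 := tendsto_first_half (V + Real.pi * Complex.I * (k + 1)) U
  have h2 := tendsto_second_half (V + Real.pi * Complex.I * (k + 1)) U
  have h3 := h1.add h2
  rw [add_zero, sigma_limit_eq] at h3
  refine h3.congr fun m => ?_
  rw [sum_QDL_eq_sum_sigmaTerm m U V hk, sum_sigmaTerm_eq m hUV hk rfl, ← Finset.sum_div,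
    ← Finset.sum_div, ← peakScale, Complex.ofReal_mul]
  ring
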